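/- arXiv:2009.11338 — 2 statements merged into one kernel-verified Lean document; each statement's English description precedes it below -/
import Mathlib

section
/- Let K ⊆ ℝⁿ be a convex body containing a unit ball with R² = E_{x∼unif(K)}‖x − z_K‖² where z_K is the centroid. If S₁, S₂ ⊆ K are axis-disjoint measurable sets and S₃ = K ∖ (S₁ ∪ S₂), then for every ε ≥ 0, vol(S₃) ≥ (c·ε/(n^{3.5} R log n)) · (min{vol(S₁), vol(S₂)} − ε·vol(K)) for an absolute constant c > 0. -/
open MeasureTheory Set
open scoped ENNReal

/-- Two sets are axis-disjoint: any point of the first agrees with any point of the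
second in at most `n − 2` coordinates. -/
def AxisDisjoint {n : ℕ} (S₁ S₂ : Set (EuclideanSpace ℝ (Fin n))) : Prop :=
  ∀ x ∈ S₁, ∀ y ∈ S₂, (Finset.univ.filter fun i => x i = y i).card ≤ n - 2

open ProbabilityTheory Filter Topology in
/-- A probability density on `ℝ` is the image of the uniform distribution on `(0, 1)` under a monotone
map whose derivative is almost everywhere the inverse of the density. -/
theorem exists_monotoneOn_hasDerivAt_inv_density {p : ℝ → ℝ≥0∞} (hp : Measurable p)
    (h1 : ∫⁻ x, p x = 1) :
    ∃ X : ℝ → ℝ, MonotoneOn X (Ioo 0 1) ∧ ∀ᵐ u ∂(volume.restrict (Ioo (0 : ℝ) 1)),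
      p (X u) ≠ 0 ∧ p (X u) ≠ ∞ ∧ HasDerivAt X (p (X u)).toReal⁻¹ u := by
  set ν := volume.withDensity p with hν
  have : IsProbabilityMeasure ν := ⟨by simpa [hν] using h1⟩
  set Φ := cdf ν with hΦ
  have hΦν : Φ.measure = ν := measure_cdf ν
  have hcont : Continuous Φ := by
    refine continuous_iff_continuousAt.2 fun a => ?_
    have h0 : Φ.measure {a} = 0 := by rw [hΦν]; exact measure_singleton a
    rw [StieltjesFunction.measure_singleton, ENNReal.ofReal_eq_zero] at h0
    rw [continuousAt_iff_continuous_left'_right']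
    refine ⟨?_, (Φ.right_continuous a).mono Ioi_subset_Ici_self⟩
    rw [Φ.mono.continuousWithinAt_Iio_iff_leftLim_eq]
    exact le_antisymm (Φ.mono.leftLim_le le_rfl) (by linarith)
  set X : ℝ → ℝ := fun u => sInf {x | u ≤ Φ x} with hX
  have hbdd : ∀ u ∈ Ioo (0 : ℝ) 1, BddBelow {x | u ≤ Φ x} := by
    intro u hu
    obtain ⟨a, ha⟩ := ((tendsto_cdf_atBot ν).eventually_lt_const hu.1).exists
    refine ⟨a, fun x hx => ?_⟩
    by_contra! hlt
    exact absurd ((Φ.mono hlt.le).trans_lt ha) (not_lt.2 hx)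
  have hne : ∀ u ∈ Ioo (0 : ℝ) 1, {x | u ≤ Φ x}.Nonempty := by
    intro u hu
    obtain ⟨a, ha⟩ := ((tendsto_cdf_atTop ν).eventually_const_lt hu.2).exists
    exact ⟨a, ha.le⟩
  have hmem : ∀ u ∈ Ioo (0 : ℝ) 1, u ≤ Φ (X u) := fun u hu =>
    (isClosed_le continuous_const hcont).csInf_mem (hne u hu) (hbdd u hu)
  have hgal : ∀ u ∈ Ioo (0 : ℝ) 1, ∀ x, X u ≤ x ↔ u ≤ Φ x := fun u hu x =>
    ⟨fun h => (hmem u hu).trans (Φ.mono h), fun h => csInf_le (hbdd u hu) h⟩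
  have hinv : ∀ u ∈ Ioo (0 : ℝ) 1, Φ (X u) = u := by
    intro u hu
    refine le_antisymm ?_ (hmem u hu)
    refine le_of_tendsto (hcont.continuousAt.mono_left nhdsWithin_le_nhds :
      Tendsto Φ (𝓝[<] (X u)) (𝓝 (Φ (X u)))) ?_
    filter_upwards [self_mem_nhdsWithin] with x hx
    by_contra! hlt
    exact absurd ((hgal u hu x).2 hlt.le) (not_le.2 hx)
  have hmono : MonotoneOn X (Ioo 0 1) := fun u hu v hv huv =>
    (hgal u hu _).2 (huv.trans (hmem v hv))
  refine ⟨X, hmono, ?_⟩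
  have hXm : AEMeasurable X (volume.restrict (Ioo (0 : ℝ) 1)) :=
    aemeasurable_restrict_of_monotoneOn measurableSet_Ioo hmono
  have hmap : (volume.restrict (Ioo (0 : ℝ) 1)).map X = ν := by
    symm
    refine Measure.ext_of_Iic _ _ fun a => ?_
    rw [Measure.map_apply_of_aemeasurable hXm measurableSet_Iic, ← ofReal_cdf,
      Measure.restrict_apply' measurableSet_Ioo]
    have h01 : X ⁻¹' Iic a ∩ Ioo 0 1 = Iic (Φ a) ∩ Ioo 0 1 := by
      ext u
      constructor
      · rintro ⟨h, hu⟩; exact ⟨(hgal u hu a).1 h, hu⟩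
      · rintro ⟨h, hu⟩; exact ⟨(hgal u hu a).2 h, hu⟩
    rw [h01, measure_congr (Filter.EventuallyEq.rfl.inter Ioo_ae_eq_Ioc)]
    have : Iic (Φ a) ∩ Ioc 0 1 = Ioc 0 (Φ a) := by
      ext u
      have := cdf_le_one ν a
      simp only [mem_inter_iff, mem_Iic, mem_Ioc]
      constructor
      · rintro ⟨h, h', -⟩; exact ⟨h', h⟩
      · rintro ⟨h, h'⟩; exact ⟨h', h, h'.trans this⟩
    rw [this, Real.volume_Ioc, sub_zero]
  have hfin : ∀ᵐ x, p x < ∞ := ae_lt_top hp (by simp [h1])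
  have hac : ν ≪ volume := withDensity_absolutelyContinuous _ _
  have hae : ∀ᵐ x ∂ν, p x ≠ 0 ∧ p x ≠ ∞ ∧ HasDerivAt Φ (p x).toReal x := by
    have h0 : ∀ᵐ x ∂ν, p x ≠ 0 := by
      rw [hν, ae_withDensity_iff hp]; exact ae_of_all _ fun x h => h
    have hd := Φ.ae_hasDerivAt
    rw [hΦν] at hd
    filter_upwards [h0, hac.ae_le hfin, hac.ae_le hd,
      hac.ae_le (Measure.rnDeriv_withDensity volume hp)] with x h0 h2 h3 h4
    rw [h4] at h3
    exact ⟨h0, h2.ne, h3⟩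
  rw [← hmap] at hae
  filter_upwards [ae_of_ae_map hXm hae, hmono.ae_differentiableWithinAt measurableSet_Ioo,
    ae_restrict_mem measurableSet_Ioo] with u hu hdiff hu01
  have hnhds : Ioo (0 : ℝ) 1 ∈ 𝓝 u := isOpen_Ioo.mem_nhds hu01
  refine ⟨hu.1, hu.2.1, HasDerivAt.of_local_left_inverse
    (hdiff.differentiableAt hnhds).continuousAt hu.2.2 (ENNReal.toReal_ne_zero.2 ⟨hu.1, hu.2.1⟩) ?_⟩
  filter_upwards [hnhds] with v hv using hinv v hv

/-- The one-dimensional transport inequality. -/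
theorem le_sum_lintegral_div_of_le_sum_div {ι : Type*} [Fintype ι] {f g : ℝ → ℝ≥0∞}
    (hf : Measurable f) (hg : Measurable g) {h : ι → ℝ → ℝ≥0∞} (hh : ∀ q, Measurable (h q))
    {t τ : ι → ℝ} (ht : ∀ q, t q ∈ Icc (0 : ℝ) 1) (hτ : ∀ q, τ q ∈ Icc (0 : ℝ) 1) {κ : ℝ}
    (hκ0 : 0 ≤ κ)
    (hκ : ∀ q, ∀ a b : ℝ, 0 < a → 0 < b →
      κ * (a ^ (1 - τ q) * b ^ τ q) ≤ (1 - t q) * a + t q * b)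
    (hF0 : ∫⁻ x, f x ≠ 0) (hF : ∫⁻ x, f x ≠ ∞) (hG0 : ∫⁻ x, g x ≠ 0) (hG : ∫⁻ x, g x ≠ ∞)
    {c : ℝ≥0∞}
    (hc : ∀ x y, f x ≠ 0 → f x ≠ ∞ → g y ≠ 0 → g y ≠ ∞ →
      c ≤ ∑ q, h q ((1 - t q) * x + t q * y) / (f x ^ (1 - τ q) * g y ^ τ q)) :
    ENNReal.ofReal κ * c ≤
      ∑ q, (∫⁻ z, h q z) / ((∫⁻ x, f x) ^ (1 - τ q) * (∫⁻ y, g y) ^ τ q) := by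
  set F := ∫⁻ x, f x with hFdef
  set G := ∫⁻ x, g x with hGdef
  obtain ⟨X, hXmono, hX⟩ := exists_monotoneOn_hasDerivAt_inv_density (p := fun x => f x / F)
    (hf.div_const F) (by
      simp only [div_eq_mul_inv]
      rw [lintegral_mul_const _ hf, ← hFdef, ENNReal.mul_inv_cancel hF0 hF])
  obtain ⟨Y, hYmono, hY⟩ := exists_monotoneOn_hasDerivAt_inv_density (p := fun x => g x / G)
    (hg.div_const G) (by
      simp only [div_eq_mul_inv]
      rw [lintegral_mul_const _ hg, ← hGdef, ENNReal.mul_inv_cancel hG0 hG])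
  obtain ⟨N, hN, hNm, hN0⟩ := exists_measurable_superset_of_null (ae_iff.1 (hX.and hY))
  set s : Set ℝ := Ioo 0 1 \ N with hs
  have hsm : MeasurableSet s := measurableSet_Ioo.diff hNm
  have hsI : s ⊆ Ioo 0 1 := sdiff_subset
  have hsv : volume s = 1 := by
    rw [Measure.restrict_apply hNm] at hN0
    rw [hs, ← sdiff_inter_self_eq_sdiff, measure_sdiff_null hN0]
    simp
  have hgood : ∀ u ∈ s, (f (X u) / F ≠ 0 ∧ f (X u) / F ≠ ∞ ∧
      HasDerivAt X (f (X u) / F).toReal⁻¹ u) ∧ (g (Y u) / G ≠ 0 ∧ g (Y u) / G ≠ ∞ ∧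
      HasDerivAt Y (g (Y u) / G).toReal⁻¹ u) := by
    intro u hu
    by_contra hcon
    exact hu.2 (hN hcon)
  have hfgood : ∀ u ∈ s, f (X u) ≠ 0 ∧ f (X u) ≠ ∞ := fun u hu =>
    ⟨fun h => (hgood u hu).1.1 (by simp [h]),
      fun h => (hgood u hu).1.2.1 (by rw [h, ENNReal.top_div_of_ne_top hF])⟩
  have hggood : ∀ u ∈ s, g (Y u) ≠ 0 ∧ g (Y u) ≠ ∞ := fun u hu =>
    ⟨fun h => (hgood u hu).2.1 (by simp [h]),
      fun h => (hgood u hu).2.2.1 (by rw [h, ENNReal.top_div_of_ne_top hG])⟩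
  set P : ι → ℝ → ℝ := fun q u => (1 - t q) * X u + t q * Y u with hP
  have hXm : AEMeasurable X (volume.restrict s) :=
    aemeasurable_restrict_of_monotoneOn hsm (hXmono.mono hsI)
  have hYm : AEMeasurable Y (volume.restrict s) :=
    aemeasurable_restrict_of_monotoneOn hsm (hYmono.mono hsI)
  have hPm : ∀ q, AEMeasurable (P q) (volume.restrict s) := fun q =>
    (hXm.const_mul _).add (hYm.const_mul _)
  have hPmono : ∀ q, MonotoneOn (P q) s := fun q u hu v hv huv =>
    add_le_add
      (mul_le_mul_of_nonneg_left (hXmono (hsI hu) (hsI hv) huv) (by linarith [(ht q).2]))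
      (mul_le_mul_of_nonneg_left (hYmono (hsI hu) (hsI hv) huv) (ht q).1)
  set φ : ι → ℝ → ℝ≥0∞ := fun q u =>
    ENNReal.ofReal κ * (h q (P q u) / (f (X u) ^ (1 - τ q) * g (Y u) ^ τ q)) with hφ
  have hφm : ∀ q, AEMeasurable (φ q) (volume.restrict s) := fun q =>
    (((hh q).comp_aemeasurable (hPm q)).div
      (((hf.comp_aemeasurable hXm).pow_const _).mul
        ((hg.comp_aemeasurable hYm).pow_const _))).const_mul _
  have hφle : ∀ q, ∫⁻ u in s, φ q u ≤ (∫⁻ z, h q z) / (F ^ (1 - τ q) * G ^ τ q) := by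
    intro q
    have hτ1 : 0 ≤ 1 - τ q := by linarith [(hτ q).2]
    have hFp0 : F ^ (1 - τ q) ≠ 0 := by simp [hF0, hF]
    have hFp : F ^ (1 - τ q) ≠ ∞ := ENNReal.rpow_ne_top_of_nonneg hτ1 hF
    have hGp0 : G ^ τ q ≠ 0 := by simp [hG0, hG]
    have hGp : G ^ τ q ≠ ∞ := ENNReal.rpow_ne_top_of_nonneg (hτ q).1 hG
    rw [ENNReal.le_div_iff_mul_le (Or.inl (mul_ne_zero hFp0 hGp0))
      (Or.inl (ENNReal.mul_ne_top hFp hGp)), ← lintegral_mul_const'' _ (hφm q)]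
    calc ∫⁻ u in s, φ q u * (F ^ (1 - τ q) * G ^ τ q)
        ≤ ∫⁻ u in s, ENNReal.ofReal ((1 - t q) * (f (X u) / F).toReal⁻¹ +
            t q * (g (Y u) / G).toReal⁻¹) * h q (P q u) := by
          refine setLIntegral_mono_ae' hsm (ae_of_all _ fun u hu => ?_)
          obtain ⟨hf0, hf1⟩ := hfgood u hu
          obtain ⟨hg0, hg1⟩ := hggood u hu
          obtain ⟨⟨ha0, ha1, -⟩, hb0, hb1, -⟩ := hgood u hu
          have hap := ENNReal.toReal_pos ha0 ha1
          have hbp := ENNReal.toReal_pos hb0 hb1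
          have hinv : ∀ {a A : ℝ≥0∞}, A ≠ ∞ → A ≠ 0 → 0 < (a / A).toReal → a / A ≠ ∞ →
              ENNReal.ofReal (a / A).toReal⁻¹ = A / a := by
            intro a A hA hA0 hpos hne
            rw [ENNReal.ofReal_inv_of_pos hpos, ENNReal.ofReal_toReal hne,
              ENNReal.inv_div (Or.inl hA) (Or.inl hA0)]
          have key := ENNReal.ofReal_le_ofReal
            (hκ q _ _ (inv_pos.2 hap) (inv_pos.2 hbp))
          rw [ENNReal.ofReal_mul hκ0, ENNReal.ofReal_mul (by positivity),
            ← ENNReal.ofReal_rpow_of_nonneg (by positivity) hτ1,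
            ← ENNReal.ofReal_rpow_of_nonneg (by positivity) (hτ q).1,
            hinv hF hF0 hap ha1, hinv hG hG0 hbp hb1, ENNReal.div_rpow_of_nonneg _ _ hτ1,
            ENNReal.div_rpow_of_nonneg _ _ (hτ q).1] at key
          refine le_trans (le_of_eq ?_) (mul_le_mul_left key _)
          have hfp : f (X u) ^ (1 - τ q) ≠ ∞ := ENNReal.rpow_ne_top_of_nonneg hτ1 hf1
          have hfp0 : f (X u) ^ (1 - τ q) ≠ 0 := by simp [hf0, hf1]
          simp only [hφ, div_eq_mul_inv]
          rw [ENNReal.mul_inv (Or.inl hfp0) (Or.inl hfp)]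
          ring
      _ = ∫⁻ z in P q '' s, h q z := by
          refine (lintegral_image_eq_lintegral_deriv_mul_of_monotoneOn hsm (fun u hu => ?_)
            (hPmono q) _).symm
          exact (((hgood u hu).1.2.2.const_mul _).add
            ((hgood u hu).2.2.2.const_mul _)).hasDerivWithinAt
      _ ≤ ∫⁻ z, h q z := setLIntegral_le_lintegral _ _
  calc ENNReal.ofReal κ * c = ∫⁻ _ in s, ENNReal.ofReal κ * c := by simp [hsv]
    _ ≤ ∫⁻ u in s, ∑ q, φ q u := by
        refine setLIntegral_mono_ae' hsm (ae_of_all _ fun u hu => ?_)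
        simp only [hφ, ← Finset.mul_sum]
        gcongr
        exact hc _ _ (hfgood u hu).1 (hfgood u hu).2 (hggood u hu).1 (hggood u hu).2
    _ = ∑ q, ∫⁻ u in s, φ q u := lintegral_finsetSum' _ fun q _ => hφm q
    _ ≤ _ := Finset.sum_le_sum fun q _ => hφle q

/-- The multi-marginal Prékopa–Leindler inequality on `ℝⁿ`, with interpolation parameters depending
on the coordinate. -/
theorem le_sum_lintegral_pi_div_of_le_sum_div {ι : Type*} [Fintype ι] {τ : ι → ℝ}
    (hτ : ∀ q, τ q ∈ Icc (0 : ℝ) 1) {κ : ℝ} (hκ0 : 0 ≤ κ) {n : ℕ} {t : ι → Fin n → ℝ}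
    (ht : ∀ q i, t q i ∈ Icc (0 : ℝ) 1)
    (hκ : ∀ q i, ∀ a b : ℝ, 0 < a → 0 < b →
      κ * (a ^ (1 - τ q) * b ^ τ q) ≤ (1 - t q i) * a + t q i * b)
    {f g : (Fin n → ℝ) → ℝ≥0∞} (hf : Measurable f) (hg : Measurable g)
    {h : ι → (Fin n → ℝ) → ℝ≥0∞} (hh : ∀ q, Measurable (h q))
    (hF0 : ∫⁻ x, f x ≠ 0) (hF : ∫⁻ x, f x ≠ ∞) (hG0 : ∫⁻ x, g x ≠ 0) (hG : ∫⁻ x, g x ≠ ∞)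
    {c : ℝ≥0∞}
    (hc : ∀ x y, f x ≠ 0 → f x ≠ ∞ → g y ≠ 0 → g y ≠ ∞ →
      c ≤ ∑ q, h q (fun i => (1 - t q i) * x i + t q i * y i) /
        (f x ^ (1 - τ q) * g y ^ τ q)) :
    ENNReal.ofReal κ ^ n * c ≤
      ∑ q, (∫⁻ z, h q z) / ((∫⁻ x, f x) ^ (1 - τ q) * (∫⁻ y, g y) ^ τ q) := by
  induction n with
  | zero =>
    simp only [volume_pi, Measure.pi_of_empty _ (0 : Fin 0 → ℝ), lintegral_dirac] at *
    rw [pow_zero, one_mul]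
    refine (hc 0 0 hF0 hF hG0 hG).trans (le_of_eq (Finset.sum_congr rfl fun q _ => ?_))
    congr 2
    exact Subsingleton.elim _ _
  | succ n ih =>
    have hsymm : ∀ z : ℝ × (Fin n → ℝ),
        (MeasurableEquiv.piFinSuccAbove (fun _ : Fin (n + 1) => ℝ) 0).symm z =
          Fin.cons z.1 z.2 := fun z => by
      simp [MeasurableEquiv.piFinSuccAbove, Fin.insertNthEquiv, Fin.insertNth_zero']
    have hcons : Measurable fun z : ℝ × (Fin n → ℝ) => (Fin.cons z.1 z.2 : Fin (n + 1) → ℝ) := by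
      simpa only [← hsymm] using
        (MeasurableEquiv.piFinSuccAbove (fun _ : Fin (n + 1) => ℝ) 0).symm.measurable
    have hsplit : ∀ {φ : (Fin (n + 1) → ℝ) → ℝ≥0∞}, Measurable φ →
        ∫⁻ x, φ x = ∫⁻ x₀, ∫⁻ x : Fin n → ℝ, φ (Fin.cons x₀ x) := by
      intro φ hφ
      have e := (volume_preserving_piFinSuccAbove (fun _ : Fin (n + 1) => ℝ) 0).symm
      rw [← e.lintegral_comp hφ, Measure.volume_eq_prod]
      simp only [hsymm]
      exact lintegral_prod _ (hφ.comp hcons).aemeasurable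
    have hm : ∀ {φ : (Fin (n + 1) → ℝ) → ℝ≥0∞}, Measurable φ →
        Measurable fun x₀ : ℝ => ∫⁻ x : Fin n → ℝ, φ (Fin.cons x₀ x) := fun hφ =>
      (hφ.comp hcons).lintegral_prod_right'
    have hslice : ∀ {φ : (Fin (n + 1) → ℝ) → ℝ≥0∞}, Measurable φ → ∀ x₀ : ℝ,
        Measurable fun x : Fin n → ℝ => φ (Fin.cons x₀ x) := fun hφ x₀ =>
      (hφ.comp hcons).comp measurable_prodMk_left
    simp only [hsplit hf, hsplit hg, hsplit (hh _)] at hF0 hF hG0 hG ⊢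
    rw [pow_succ', mul_assoc]
    refine le_sum_lintegral_div_of_le_sum_div (hm hf) (hm hg) (fun q => hm (hh q))
      (fun q => ht q 0) hτ hκ0 (fun q => hκ q 0) hF0 hF hG0 hG ?_
    intro x₀ y₀ hx0 hx1 hy0 hy1
    refine ih (t := fun q i => t q i.succ) (fun q i => ht q i.succ) (fun q i => hκ q i.succ)
      (hslice hf x₀) (hslice hg y₀) (fun q => hslice (hh q) _) hx0 hx1 hy0 hy1 ?_
    intro x y hfx hfx' hgy hgy'
    refine (hc _ _ hfx hfx' hgy hgy').trans (le_of_eq ?_)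
    refine Finset.sum_congr rfl fun q _ => ?_
    congr 2
    funext i
    refine Fin.cases ?_ (fun i => ?_) i <;> simp
/-- If every pair of points of `A` and `B` has one of finitely many coordinatewise interpolations in
`S`, then the volume of `S` is bounded below by the smaller of the volumes of `A` and `B`. -/
theorem pow_mul_min_volume_le_card_mul_volume {ι : Type*} [Fintype ι] {τ : ι → ℝ}
    (hτ : ∀ q, τ q ∈ Icc (0 : ℝ) 1) {κ : ℝ} (hκ0 : 0 ≤ κ) {n : ℕ} {t : ι → Fin n → ℝ}
    (ht : ∀ q i, t q i ∈ Icc (0 : ℝ) 1)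
    (hκ : ∀ q i, ∀ a b : ℝ, 0 < a → 0 < b →
      κ * (a ^ (1 - τ q) * b ^ τ q) ≤ (1 - t q i) * a + t q i * b)
    {A B S : Set (EuclideanSpace ℝ (Fin n))} (hA : MeasurableSet A) (hB : MeasurableSet B)
    (hS : MeasurableSet S) (hAfin : volume A ≠ ∞) (hBfin : volume B ≠ ∞)
    (hmeet : ∀ x ∈ A, ∀ y ∈ B,
      ∃ q, WithLp.toLp 2 (fun i => (1 - t q i) * x i + t q i * y i) ∈ S) :
    ENNReal.ofReal κ ^ n * min (volume A) (volume B) ≤ Fintype.card ι * volume S := by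
  rcases eq_or_ne (volume A) 0 with hA0 | hA0
  · simp [hA0]
  rcases eq_or_ne (volume B) 0 with hB0 | hB0
  · simp [hB0]
  set e : (Fin n → ℝ) → EuclideanSpace ℝ (Fin n) := WithLp.toLp 2
  have hpres : MeasurePreserving e := PiLp.volume_preserving_toLp (Fin n)
  have hvol : ∀ {T : Set (EuclideanSpace ℝ (Fin n))}, MeasurableSet T →
      ∫⁻ x, (e ⁻¹' T).indicator 1 x = volume T := fun {T} hT => by
    rw [lintegral_indicator_one (hpres.measurable hT), hpres.measure_preimage hT.nullMeasurableSet]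
  have hmeas : ∀ {T : Set (EuclideanSpace ℝ (Fin n))}, MeasurableSet T →
      Measurable ((e ⁻¹' T).indicator (1 : (Fin n → ℝ) → ℝ≥0∞)) := fun hT =>
    measurable_one.indicator (hpres.measurable hT)
  have key := le_sum_lintegral_pi_div_of_le_sum_div hτ hκ0 ht hκ (hmeas hA) (hmeas hB)
    (h := fun _ => (e ⁻¹' S).indicator 1) (fun _ => hmeas hS) (by rwa [hvol hA])
    (by rwa [hvol hA]) (by rwa [hvol hB]) (by rwa [hvol hB]) (c := 1) (by
      intro x y hx _ hy _
      have hx : e x ∈ A := by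
        by_contra h
        exact hx (indicator_of_notMem (s := e ⁻¹' A) h _)
      have hy : e y ∈ B := by
        by_contra h
        exact hy (indicator_of_notMem (s := e ⁻¹' B) h _)
      obtain ⟨q, hq⟩ := hmeet _ hx _ hy
      refine le_trans (le_of_eq ?_) (Finset.single_le_sum (fun _ _ => zero_le) (Finset.mem_univ q))
      rw [indicator_of_mem (s := e ⁻¹' A) hx, indicator_of_mem (s := e ⁻¹' B) hy,
        indicator_of_mem (s := e ⁻¹' S) hq]
      simp)
  simp only [hvol hA, hvol hB, hvol hS, mul_one] at key
  set m := min (volume A) (volume B) with hm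
  have hm0 : m ≠ 0 := by simp [hm, min_eq_iff, hA0, hB0]
  have hmfin : m ≠ ∞ := ne_top_of_le_ne_top hAfin (min_le_left _ _)
  rw [← ENNReal.le_div_iff_mul_le (Or.inl hm0) (Or.inl hmfin)]
  calc ENNReal.ofReal κ ^ n
      ≤ ∑ q, volume S / (volume A ^ (1 - τ q) * volume B ^ τ q) := key
    _ ≤ ∑ _ : ι, volume S / m := by
        gcongr with q
        calc m = m ^ (1 - τ q) * m ^ τ q := by
              rw [← ENNReal.rpow_add _ _ hm0 hmfin]; simp
          _ ≤ _ := by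
              gcongr
              · linarith [(hτ q).2]
              · exact min_le_left _ _
              · exact (hτ q).1
              · exact min_le_right _ _
    _ = Fintype.card ι * volume S / m := by
        rw [Finset.sum_const, Finset.card_univ, nsmul_eq_mul, mul_div_assoc]

/-- A quantitative form of the weighted arithmetic-geometric mean inequality for mismatched weights. -/
theorem mul_rpow_mul_rpow_le_of_mul_le {κ a τ x y : ℝ} (hτ : τ ∈ Icc (0 : ℝ) 1)
    (h₁ : κ * (1 - τ) ≤ 1 - a) (h₂ : κ * τ ≤ a) (hκ : 0 ≤ κ) (hx : 0 < x) (hy : 0 < y) :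
    κ * (x ^ (1 - τ) * y ^ τ) ≤ (1 - a) * x + a * y := by
  have h := Real.geom_mean_le_arith_mean2_weighted (sub_nonneg.2 hτ.2) hτ.1 hx.le hy.le (by ring)
  nlinarith [mul_le_mul_of_nonneg_left h hκ, mul_le_mul_of_nonneg_right h₁ hx.le,
    mul_le_mul_of_nonneg_right h₂ hy.le]

/-- The weight of coordinate `i` in the staircase path with `m` stages after the first `k` coordinates
of stage `j` have been moved. -/
noncomputable def stairWeight {n : ℕ} (m : ℕ) (q : Fin m × Fin (n + 1)) (i : Fin n) : ℝ :=
  if (i : ℕ) < q.2 then ((q.1 : ℝ) + 1) / m else q.1 / m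

theorem stairWeight_mem_Icc {n m : ℕ} (q : Fin m × Fin (n + 1)) (i : Fin n) :
    stairWeight m q i ∈ Icc (0 : ℝ) 1 := by
  have hm : (0 : ℝ) < m := by exact_mod_cast q.1.pos
  have hq : (q.1 : ℝ) + 1 ≤ m := by exact_mod_cast q.1.isLt
  unfold stairWeight
  split_ifs
  · exact ⟨by positivity, (div_le_one hm).2 hq⟩
  · exact ⟨by positivity, (div_le_one hm).2 (by linarith)⟩

/-- In each stage of the staircase path the weights are comparable with a common weight. -/
theorem exists_weight_stairWeight {n m : ℕ} (hm : 2 ≤ m) (q : Fin m × Fin (n + 1)) :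
    ∃ τ ∈ Icc (0 : ℝ) 1, ∀ i, ∀ a b : ℝ, 0 < a → 0 < b →
      (1 - 2 / (m : ℝ)) * (a ^ (1 - τ) * b ^ τ) ≤
        (1 - stairWeight m q i) * a + stairWeight m q i * b := by
  have hm0 : (0 : ℝ) < m := by exact_mod_cast q.1.pos
  have hm2 : (2 : ℝ) ≤ m := by exact_mod_cast hm
  have hq : (q.1 : ℝ) + 1 ≤ m := by exact_mod_cast q.1.isLt
  set d : ℝ := 1 / m with hd
  set s : ℝ := q.1 / m with hs
  have hd0 : 0 < d := by positivity
  have hs0 : 0 ≤ s := by positivity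
  have hsd : ((q.1 : ℝ) + 1) / m = s + d := by rw [hs, hd]; ring
  have hsd1 : s + d ≤ 1 := by rw [← hsd]; exact (div_le_one hm0).2 hq
  have h2d : 2 / (m : ℝ) = 2 * d := by rw [hd]; ring
  have hκ : 0 ≤ 1 - 2 * d := by rw [← h2d, sub_nonneg]; exact (div_le_one hm0).2 hm2
  rw [h2d]
  rcases le_total s (1 / 2) with h | h
  · refine ⟨s, ⟨hs0, by linarith⟩, fun i a b ha hb => ?_⟩
    refine mul_rpow_mul_rpow_le_of_mul_le ⟨hs0, by linarith⟩ ?_ ?_ hκ ha hb <;>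
    · unfold stairWeight
      rw [hsd]
      split_ifs <;> nlinarith
  · refine ⟨s + d, ⟨by linarith, hsd1⟩, fun i a b ha hb => ?_⟩
    refine mul_rpow_mul_rpow_le_of_mul_le ⟨by linarith, hsd1⟩ ?_ ?_ hκ ha hb <;>
    · unfold stairWeight
      rw [hsd]
      split_ifs <;> nlinarith
/-- The point of the staircase path from `x` to `y` with the weights `stairWeight m q`. -/
noncomputable def stairPoint {n m : ℕ} (x y : EuclideanSpace ℝ (Fin n))
    (q : Fin m × Fin (n + 1)) : EuclideanSpace ℝ (Fin n) :=
  WithLp.toLp 2 fun i => (1 - stairWeight m q i) * x i + stairWeight m q i * y i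

theorem AxisDisjoint.notMem_of_eq_off {n : ℕ} (hn : 2 ≤ n)
    {S₁ S₂ : Set (EuclideanSpace ℝ (Fin n))} (h : AxisDisjoint S₁ S₂)
    {x y : EuclideanSpace ℝ (Fin n)} (hx : x ∈ S₁) (k : Fin n) (hxy : ∀ i, i ≠ k → x i = y i) :
    y ∉ S₂ := by
  intro hy
  have h₁ := h x hx y hy
  have h₂ : (Finset.univ.erase k).card ≤ (Finset.univ.filter fun i => x i = y i).card :=
    Finset.card_le_card fun i hi => by simpa using hxy i (Finset.ne_of_mem_erase hi)
  rw [Finset.card_erase_of_mem (Finset.mem_univ k), Finset.card_univ, Fintype.card_fin] at h₂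
  omega

/-- A staircase path inside `K` joining two axis-disjoint sets leaves their union. -/
theorem AxisDisjoint.exists_stairPoint_mem_diff {n m : ℕ} (hn : 2 ≤ n) (hm : 0 < m)
    {K S₁ S₂ : Set (EuclideanSpace ℝ (Fin n))} (h : AxisDisjoint S₁ S₂)
    {x y : EuclideanSpace ℝ (Fin n)} (hx : x ∈ S₁) (hy : y ∈ S₂)
    (hK : ∀ q : Fin m × Fin (n + 1), stairPoint x y q ∈ K) :
    ∃ q : Fin m × Fin (n + 1), stairPoint x y q ∈ K \ (S₁ ∪ S₂) := by
  by_contra! hcon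
  have hmem : ∀ q : Fin m × Fin (n + 1), stairPoint x y q ∈ S₁ ∪ S₂ := fun q => by
    by_contra hq
    exact hcon q ⟨hK q, hq⟩
  have hrow : ∀ j : Fin m, stairPoint x y (j, (0 : Fin (n + 1))) ∈ S₁ →
      ∀ k : Fin (n + 1), stairPoint x y (j, k) ∈ S₁ := by
    intro j hj k
    induction k using Fin.induction with
    | zero => exact hj
    | succ k ih =>
      refine (hmem _).resolve_right (h.notMem_of_eq_off hn ih k fun i hi => ?_)
      have hik : i < k ↔ i ≤ k := ⟨le_of_lt, fun h => lt_of_le_of_ne h hi⟩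
      simp [stairPoint, stairWeight, hik]
  have hall : ∀ j (hj : j < m), stairPoint x y ((⟨j, hj⟩ : Fin m), (0 : Fin (n + 1))) ∈ S₁ := by
    intro j
    induction j with
    | zero =>
      intro hj
      convert hx
      ext i
      simp [stairPoint, stairWeight]
    | succ j ih =>
      intro hj
      convert hrow ⟨j, Nat.lt_of_succ_lt hj⟩ (ih (Nat.lt_of_succ_lt hj)) (Fin.last n) using 1
      ext i
      simp [stairPoint, stairWeight]
  have hlast := hrow ⟨m - 1, by omega⟩ (hall (m - 1) (by omega)) (Fin.last n)
  refine h.notMem_of_eq_off hn hlast ⟨0, by omega⟩ (fun i _ => ?_) hy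
  have hm0 : (m : ℝ) ≠ 0 := by positivity
  have hm1 : ((m - 1 : ℕ) : ℝ) + 1 = m := by exact_mod_cast Nat.sub_add_cancel hm
  simp [stairPoint, stairWeight, hm1, hm0]

/-- Staircase points are close to the segment. -/
theorem norm_stairPoint_sub_le {n m : ℕ} (x y : EuclideanSpace ℝ (Fin n))
    (q : Fin m × Fin (n + 1)) :
    ‖stairPoint x y q - AffineMap.lineMap x y ((q.1 : ℝ) / m)‖ ≤ 1 / (m : ℝ) * ‖y - x‖ := by
  have hm : (0 : ℝ) < m := by exact_mod_cast q.1.pos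
  have hm' : ‖1 / (m : ℝ)‖ = 1 / m := Real.norm_of_nonneg (by positivity)
  rw [← hm', ← norm_smul, EuclideanSpace.norm_eq, EuclideanSpace.norm_eq]
  refine Real.sqrt_le_sqrt (Finset.sum_le_sum fun i _ => ?_)
  have : (stairPoint x y q - AffineMap.lineMap x y ((q.1 : ℝ) / m)) i =
      (stairWeight m q i - q.1 / m) * (y i - x i) := by
    simp [stairPoint, AffineMap.lineMap_apply]
    ring
  rw [this, PiLp.smul_apply, PiLp.sub_apply, smul_eq_mul, norm_mul, norm_mul]
  gcongr
  rw [hm', Real.norm_eq_abs, abs_le]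
  have : 0 < 1 / (m : ℝ) := by positivity
  unfold stairWeight
  split_ifs
  · rw [add_div]; constructor <;> linarith
  · constructor <;> linarith

/-- A convex set containing a unit ball contains the `s`-neighbourhood of its contraction by the
factor `1 - s` towards the centre of the ball. -/
theorem Convex.mem_of_norm_sub_homothety_le {E : Type*} [NormedAddCommGroup E] [NormedSpace ℝ E]
    {K : Set E} (hK : Convex ℝ K) {z : E} (hz : Metric.closedBall z 1 ⊆ K) {s : ℝ} (hs0 : 0 < s)
    (hs1 : s ≤ 1) {p q : E} (hp : p ∈ AffineMap.homothety z (1 - s) '' K) (hpq : ‖q - p‖ ≤ s) :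
    q ∈ K := by
  obtain ⟨k, hk, rfl⟩ := hp
  have hb : z + s⁻¹ • (q - AffineMap.homothety z (1 - s) k) ∈ K := by
    refine hz ?_
    rw [Metric.mem_closedBall, dist_eq_norm, add_sub_cancel_left, norm_smul, norm_inv,
      Real.norm_of_nonneg hs0.le]
    exact inv_mul_le_one_of_le₀ hpq hs0.le
  have := hK hk hb (sub_nonneg.2 hs1) hs0.le (by ring)
  convert this using 1
  rw [smul_add, smul_smul, mul_inv_cancel₀ hs0.ne', one_smul, AffineMap.homothety_apply]
  simp only [vsub_eq_sub, vadd_eq_add]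
  module

/-- The contraction of a convex set towards one of its points by a factor `1 - s` loses at most a
fraction `n * s` of the volume. -/
theorem volume_diff_image_homothety_le {n : ℕ} {K : Set (EuclideanSpace ℝ (Fin n))}
    (hK : Convex ℝ K) (hKc : IsCompact K) {z : EuclideanSpace ℝ (Fin n)} (hz : z ∈ K) {s : ℝ}
    (hs0 : 0 ≤ s) (hs1 : s ≤ 1) :
    volume (K \ AffineMap.homothety z (1 - s) '' K) ≤ ENNReal.ofReal (n * s) * volume K := by
  have hsub : AffineMap.homothety z (1 - s) '' K ⊆ K := by
    rintro _ ⟨k, hk, rfl⟩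
    rw [AffineMap.homothety_eq_lineMap]
    exact hK.lineMap_mem hz hk ⟨by linarith, by linarith⟩
  have hcpt : IsCompact (AffineMap.homothety z (1 - s) '' K) :=
    hKc.image (AffineMap.homothety_continuous z _)
  rw [measure_sdiff hsub hcpt.measurableSet.nullMeasurableSet hcpt.measure_lt_top.ne,
    Measure.addHaar_image_homothety, finrank_euclideanSpace_fin, tsub_le_iff_right, ← add_mul]
  refine le_mul_of_one_le_left zero_le ?_
  rw [← ENNReal.ofReal_add (by positivity) (by positivity), ENNReal.one_le_ofReal,
    abs_of_nonneg (by have := sub_nonneg.2 hs1; positivity)]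
  have := one_add_mul_le_pow (a := -s) (by linarith) n
  rw [← sub_eq_add_neg] at this
  linarith

/-- A convex body is contained in a ball whose radius is of order `n` times the root mean square
distance to the centre. -/
theorem norm_sub_le_of_sq_eq_average {n : ℕ} (hn : 0 < n) {K : Set (EuclideanSpace ℝ (Fin n))}
    (hK : Convex ℝ K) (hKc : IsCompact K) (hK0 : volume K ≠ 0) (z : EuclideanSpace ℝ (Fin n))
    {R : ℝ} (hR : 0 < R) (hRK : R ^ 2 = ⨍ x in K, ‖x - z‖ ^ 2) {y : EuclideanSpace ℝ (Fin n)}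
    (hy : y ∈ K) : ‖y - z‖ ≤ 8 * n * R := by
  by_contra! hlt
  have hn1 : (1 : ℝ) ≤ n := by exact_mod_cast hn
  have hKfin : volume K ≠ ∞ := hKc.measure_lt_top.ne
  have hV : 0 < volume.real K := ENNReal.toReal_pos hK0 hKfin
  have hint : IntegrableOn (fun x => ‖x - z‖ ^ 2) K :=
    (by fun_prop : Continuous fun x => ‖x - z‖ ^ 2).continuousOn.integrableOn_compact hKc
  set G := {x ∈ K | ‖x - z‖ < 2 * R} with hG
  have hGK : G ⊆ K := sep_subset _ _
  have hGm : MeasurableSet G :=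
    hKc.measurableSet.inter (measurableSet_lt (measurable_id.sub_const z).norm measurable_const)
  have hGfin : volume G ≠ ∞ := measure_ne_top_of_subset hGK hKfin
  have hmarkov : 3 / 4 * volume.real K ≤ volume.real G := by
    have h := mul_meas_ge_le_integral_of_nonneg (μ := volume.restrict K)
      (ae_of_all _ fun x => by positivity) hint ((2 * R) ^ 2)
    have hset : {x | (2 * R) ^ 2 ≤ ‖x - z‖ ^ 2} ∩ K = K \ G := by
      ext x
      have : (2 * R) ^ 2 ≤ ‖x - z‖ ^ 2 ↔ 2 * R ≤ ‖x - z‖ :=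
        pow_le_pow_iff_left₀ (by positivity) (norm_nonneg _) two_ne_zero
      simp only [hG, mem_inter_iff, mem_ofPred_eq, mem_sdiff, this]
      constructor
      · rintro ⟨h, hx⟩; exact ⟨hx, fun h' => absurd h'.2 (not_lt.2 h)⟩
      · rintro ⟨hx, h⟩; exact ⟨not_lt.1 fun h' => h ⟨hx, h'⟩, hx⟩
    rw [measureReal_restrict_apply' hKc.measurableSet, hset] at h
    rw [setAverage_eq, smul_eq_mul, inv_mul_eq_div, eq_div_iff hV.ne'] at hRK
    rw [← hRK, measureReal_sdiff hGK hGm hKfin] at h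
    have hR2 : 0 < R ^ 2 := by positivity
    have : R ^ 2 * (4 * (volume.real K - volume.real G)) ≤ R ^ 2 * volume.real K := by
      linarith
    linarith [le_of_mul_le_mul_left this hR2]
  set r : ℝ := 1 - 1 / (2 * n) with hr
  have hr0 : 0 ≤ r := by
    rw [hr, sub_nonneg, div_le_one (by positivity)]; linarith
  have hr1 : r ≤ 1 := by rw [hr]; linarith [show 0 < 1 / (2 * (n : ℝ)) by positivity]
  have himK : AffineMap.homothety y r '' G ⊆ K := by
    rintro _ ⟨k, hk, rfl⟩
    rw [AffineMap.homothety_eq_lineMap]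
    exact hK.lineMap_mem hy (hGK hk) ⟨hr0, hr1⟩
  have hdisj : Disjoint (AffineMap.homothety y r '' G) G := by
    rw [Set.disjoint_left]
    rintro _ ⟨x, hx, rfl⟩ hxG
    have h₁ : ‖x - z‖ < 2 * R := hx.2
    have h₂ : ‖AffineMap.homothety y r x - z‖ < 2 * R := hxG.2
    have h₃ : (1 / (2 * (n : ℝ))) • (y - z) = (AffineMap.homothety y r x - z) - r • (x - z) := by
      rw [AffineMap.homothety_apply, hr]
      simp only [vsub_eq_sub, vadd_eq_add]
      module
    have h₄ := norm_sub_le (AffineMap.homothety y r x - z) (r • (x - z))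
    rw [← h₃, norm_smul, norm_smul, Real.norm_of_nonneg hr0,
      Real.norm_of_nonneg (by positivity), one_div, inv_mul_eq_div] at h₄
    have h₅ : r * ‖x - z‖ ≤ 2 * R := by nlinarith [norm_nonneg (x - z)]
    have h₆ : 4 * R < ‖y - z‖ / (2 * n) := by
      rw [lt_div_iff₀ (by positivity)]; linarith
    linarith
  have hvol : volume.real (AffineMap.homothety y r '' G) = r ^ n * volume.real G := by
    rw [measureReal_def, Measure.addHaar_image_homothety, finrank_euclideanSpace_fin,
      ENNReal.toReal_mul, ENNReal.toReal_ofReal (abs_nonneg _), abs_of_nonneg (by positivity)]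
    rfl
  have hpow : 1 / 2 ≤ r ^ n := by
    have := one_add_mul_le_pow (a := -(1 / (2 * (n : ℝ)))) (by rw [hr] at hr0; linarith) n
    rw [← sub_eq_add_neg, ← hr] at this
    refine le_trans (le_of_eq ?_) this
    field_simp
    norm_num
  have hunion := measureReal_mono (union_subset himK hGK) hKfin
  rw [measureReal_union hdisj hGm (measure_ne_top_of_subset himK hKfin) hGfin, hvol] at hunion
  nlinarith [measureReal_nonneg (μ := volume) (s := G)]

/-- main ℓ₀-isoperimetric inequality: for a convex body `K` containing a
unit ball with `R² = E‖x − z_K‖²`, axis-disjoint measurable `S₁, S₂ ⊆ K` and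
`S₃ = K \ (S₁ ∪ S₂)`, for every `ε ≥ 0`,
`vol(S₃) ≥ (c·ε/(n^{3.5} R log n)) · (min{vol(S₁), vol(S₂)} − ε·vol(K))`. -/
theorem axis_disjoint_isoperimetry :
    ∃ c > (0 : ℝ), ∀ (n : ℕ) (K : Set (EuclideanSpace ℝ (Fin n))),
      Convex ℝ K → IsCompact K → (interior K).Nonempty →
      (∃ z₀, Metric.closedBall z₀ 1 ⊆ K) →
      ∀ R : ℝ, 0 < R → R ^ 2 = ⨍ x in K, ‖x - ⨍ y in K, y‖ ^ 2 →
      ∀ S₁ S₂ : Set (EuclideanSpace ℝ (Fin n)), MeasurableSet S₁ → MeasurableSet S₂ →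
        S₁ ⊆ K → S₂ ⊆ K → AxisDisjoint S₁ S₂ →
        ∀ ε : ℝ, 0 ≤ ε →
          volume (K \ (S₁ ∪ S₂)) ≥
            ENNReal.ofReal (c * ε / ((n : ℝ) ^ (3.5 : ℝ) * R * Real.log n)) *
              (min (volume S₁) (volume S₂) - ENNReal.ofReal ε * volume K) := by
  refine ⟨1 / 512, by norm_num, ?_⟩
  intro n K hK hKc hKint ⟨z₀, hz₀⟩ R hR hRK S₁ S₂ hS₁ hS₂ hS₁K hS₂K hdisj ε hε
  rcases Nat.lt_or_ge n 2 with hn | hn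
  · interval_cases n <;> simp
  rcases hε.eq_or_lt with rfl | hε0
  · simp
  rcases lt_or_ge 1 ε with hε1 | hε1
  · have h0 : min (volume S₁) (volume S₂) - ENNReal.ofReal ε * volume K = 0 := by
      refine tsub_eq_zero_of_le ((min_le_left _ _).trans ((measure_mono hS₁K).trans ?_))
      exact le_mul_of_one_le_left zero_le (ENNReal.one_le_ofReal.2 hε1.le)
    rw [h0, mul_zero]
    exact zero_le
  have hn2 : (2 : ℝ) ≤ n := by exact_mod_cast hn
  have hKfin : volume K ≠ ∞ := hKc.measure_lt_top.ne
  have hK0 : volume K ≠ 0 := (Measure.measure_pos_of_nonempty_interior _ hKint).ne'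
  have hz₀K : z₀ ∈ K := hz₀ (Metric.mem_closedBall_self zero_le_one)
  set D : ℝ := 32 * n * R with hD
  have hdiam : ∀ x ∈ K, ∀ y ∈ K, 2 * ‖y - x‖ ≤ D := by
    intro x hx y hy
    have h₁ := norm_sub_le_of_sq_eq_average (by omega) hK hKc hK0 _ hR hRK hx
    have h₂ := norm_sub_le_of_sq_eq_average (by omega) hK hKc hK0 _ hR hRK hy
    have h₃ := norm_sub_le_norm_sub_add_norm_sub y (⨍ y in K, y) x
    rw [norm_sub_rev (⨍ y in K, y) x] at h₃
    linarith
  have hD4 : 4 ≤ D := by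
    set v : EuclideanSpace ℝ (Fin n) := EuclideanSpace.single ⟨0, by omega⟩ 1
    have hv : ‖v‖ = 1 := by simp [v]
    have h₁ : z₀ + v ∈ K := hz₀ (by simp [hv])
    have h₂ : z₀ - v ∈ K := hz₀ (by simp [hv])
    have h₃ := hdiam _ h₂ _ h₁
    rw [show z₀ + v - (z₀ - v) = (2 : ℝ) • v by module, norm_smul, hv] at h₃
    norm_num at h₃
    linarith
  set s : ℝ := ε / n with hs
  have hs0 : 0 < s := by positivity
  have hs1 : s ≤ 1 := by rw [hs, div_le_one (by positivity)]; linarith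
  have hns : n * s = ε := by rw [hs]; field_simp
  set m : ℕ := ⌈D / s⌉₊ with hm
  have hmge : D / s ≤ m := Nat.le_ceil _
  have hDs : 4 * n ≤ D / s := by
    rw [le_div_iff₀ hs0, mul_assoc, hns]; linarith
  have hmle : (m : ℝ) ≤ 2 * (D / s) := by
    have := Nat.ceil_lt_add_one (show 0 ≤ D / s by linarith)
    linarith
  have hm8 : (8 : ℝ) ≤ m := by linarith
  have hm2 : 2 ≤ m := by exact_mod_cast (by linarith : (2 : ℝ) ≤ m)
  have hmpos : (0 : ℝ) < m := by linarith
  set K' := AffineMap.homothety z₀ (1 - s) '' K with hK'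
  have hK'conv : Convex ℝ K' := hK.affine_image _
  have hK'm : MeasurableSet K' :=
    (hKc.image (AffineMap.homothety_continuous z₀ _)).measurableSet
  have hstair : ∀ x ∈ K ∩ K', ∀ y ∈ K ∩ K', ∀ q : Fin m × Fin (n + 1), stairPoint x y q ∈ K := by
    intro x hx y hy q
    have hq : (q.1 : ℝ) ≤ m := by exact_mod_cast q.1.isLt.le
    refine hK.mem_of_norm_sub_homothety_le hz₀ hs0 hs1
      (hK'conv.lineMap_mem hx.2 hy.2 ⟨by positivity, (div_le_one hmpos).2 hq⟩)
      ((norm_stairPoint_sub_le x y q).trans ?_)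
    rw [one_div, inv_mul_le_iff₀ hmpos]
    have := hdiam x hx.1 y hy.1
    have := (div_le_iff₀ hs0).1 hmge
    linarith [norm_nonneg (y - x)]
  choose τ hτ hτle using fun q : Fin m × Fin (n + 1) => exists_weight_stairWeight hm2 q
  have hκ0 : 0 ≤ 1 - 2 / (m : ℝ) := by
    rw [sub_nonneg, div_le_one hmpos]; linarith
  set S₃ := K \ (S₁ ∪ S₂) with hS₃
  have hfin : ∀ {S : Set (EuclideanSpace ℝ (Fin n))}, S ⊆ K → volume (S ∩ K') ≠ ∞ := fun hS =>
    measure_ne_top_of_subset (inter_subset_left.trans hS) hKfin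
  have hmain := pow_mul_min_volume_le_card_mul_volume hτ hκ0 stairWeight_mem_Icc hτle
    (hS₁.inter hK'm) (hS₂.inter hK'm) (hKc.measurableSet.diff (hS₁.union hS₂)) (hfin hS₁K)
    (hfin hS₂K) (fun x hx y hy => hdisj.exists_stairPoint_mem_diff hn (by omega) hx.1 hy.1
      (hstair x ⟨hS₁K hx.1, hx.2⟩ y ⟨hS₂K hy.1, hy.2⟩))
  have hloss : ∀ {S : Set (EuclideanSpace ℝ (Fin n))}, S ⊆ K →
      volume S - ENNReal.ofReal ε * volume K ≤ volume (S ∩ K') := by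
    intro S hS
    rw [tsub_le_iff_right]
    have h := volume_diff_image_homothety_le hK hKc hz₀K hs0.le hs1
    rw [hns] at h
    calc volume S ≤ volume (S ∩ K') + volume (S \ K') := measure_le_inter_add_sdiff _ _ _
      _ ≤ volume (S ∩ K') + ENNReal.ofReal ε * volume K := by
          gcongr
          exact (measure_mono (sdiff_subset_sdiff_left hS)).trans h
  have hmin : min (volume S₁) (volume S₂) - ENNReal.ofReal ε * volume K ≤
      min (volume (S₁ ∩ K')) (volume (S₂ ∩ K')) :=
    le_min ((tsub_le_tsub_right (min_le_left _ _) _).trans (hloss hS₁K))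
      ((tsub_le_tsub_right (min_le_right _ _) _).trans (hloss hS₂K))
  have hpow : 1 / 2 ≤ (1 - 2 / (m : ℝ)) ^ n := by
    have h := one_add_mul_le_pow (a := -(2 / (m : ℝ))) (by linarith) n
    rw [← sub_eq_add_neg] at h
    have h' : n * (2 / (m : ℝ)) ≤ 1 / 2 := by
      rw [← mul_div_assoc, div_le_iff₀ hmpos]; linarith
    linarith
  have hcard : (Fintype.card (Fin m × Fin (n + 1)) : ℝ≥0∞) = ENNReal.ofReal (m * (n + 1)) := by
    rw [Fintype.card_prod, Fintype.card_fin, Fintype.card_fin, ← ENNReal.ofReal_natCast]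
    push_cast
    rfl
  have hN : (0 : ℝ) < m * (n + 1) := by positivity
  have hcoeff : 1 / 512 * ε / ((n : ℝ) ^ (3.5 : ℝ) * R * Real.log n) * (m * (n + 1)) ≤ 1 / 2 := by
    have hlog : 1 / 2 ≤ Real.log n := by
      have := Real.log_two_gt_d9
      have := Real.log_le_log two_pos hn2
      linarith
    have hn3 : (n : ℝ) ^ 3 ≤ (n : ℝ) ^ (3.5 : ℝ) := by
      rw [← Real.rpow_natCast]
      exact Real.rpow_le_rpow_of_exponent_le (by linarith) (by norm_num)
    have hden : (n : ℝ) ^ 3 * R * (1 / 2) ≤ (n : ℝ) ^ (3.5 : ℝ) * R * Real.log n := by gcongr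
    have hcount : (m : ℝ) * (n + 1) * ε ≤ 128 * ((n : ℝ) ^ 3 * R) := by
      calc (m : ℝ) * (n + 1) * ε ≤ 2 * (D / s) * (2 * n) * ε := by gcongr; linarith
        _ = 128 * ((n : ℝ) ^ 3 * R) := by rw [hD, hs]; field_simp; norm_num
    have hpos : 0 < (n : ℝ) ^ 3 * R * (1 / 2) := by positivity
    rw [div_mul_eq_mul_div, div_le_iff₀ (hpos.trans_le hden)]
    linarith
  have hN0 : ENNReal.ofReal (m * (n + 1)) ≠ 0 := (ENNReal.ofReal_pos.2 hN).ne'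
  rw [ge_iff_le, ← ENNReal.mul_le_mul_iff_right hN0 ENNReal.ofReal_ne_top, ← hcard]
  refine le_trans ?_ hmain
  rw [hcard, ← mul_assoc, ← ENNReal.ofReal_mul hN.le, ← ENNReal.ofReal_pow hκ0]
  gcongr
  rw [mul_comm]
  exact hcoeff.trans hpow
end

section
/- Let K be a convex body in ℝⁿ containing a unit ball with R² = E_{unif(K)}‖x − z_K‖². Then the s-conductance of the Coordinate Hit-and-Run chain on K is at least c·s/(R·n^{4.5}·log n) for an absolute constant c > 0. -/
open MeasureTheory Set
open scoped ENNReal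

/-- One-step transition probability of Coordinate Hit-and-Run on `K` from `x` into `S`:
pick a uniform coordinate direction, then a uniform point of the chord through `x`. -/
noncomputable def charP (n : ℕ) (K S : Set (EuclideanSpace ℝ (Fin n)))
    (x : EuclideanSpace ℝ (Fin n)) : ℝ≥0∞ :=
  (n : ℝ≥0∞)⁻¹ * ∑ j : Fin n,
    volume {t : ℝ | x + t • EuclideanSpace.single j (1 : ℝ) ∈ S} /
      volume {t : ℝ | x + t • EuclideanSpace.single j (1 : ℝ) ∈ K}

section PrekopaLeindler

open scoped Pointwise

/-- One-dimensional Brunn–Minkowski inequality, compact case. -/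
theorem volume_add_volume_le_of_isCompact {A B C : Set ℝ} (hA : IsCompact A) (hB : IsCompact B)
    (hA0 : A.Nonempty) (hB0 : B.Nonempty) (h : ∀ a ∈ A, ∀ b ∈ B, a + b ∈ C) :
    volume A + volume B ≤ volume C := by
  obtain ⟨M, hM, hMu⟩ := hA.exists_isGreatest hA0
  obtain ⟨m, hm, hml⟩ := hB.exists_isLeast hB0
  have h1 : volume ((fun x => x + m) '' A) = volume A := by simp
  have h2 : volume ((fun x => M + x) '' B) = volume B := by simp
  have hsub : (fun x => x + m) '' A ∪ (fun x => M + x) '' B ⊆ C := by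
    rintro _ (⟨a, ha, rfl⟩ | ⟨b, hb, rfl⟩)
    · exact h a ha m hm
    · exact h M hM b hb
  have hdisj : AEDisjoint volume ((fun x => x + m) '' A) ((fun x => M + x) '' B) := by
    refine measure_mono_null (t := {M + m}) ?_ (by simp)
    rintro _ ⟨⟨a, ha, rfl⟩, ⟨b, hb, hab⟩⟩
    have := hMu ha
    have := hml hb
    simp only [mem_singleton_iff] at *
    linarith
  have hBm : MeasurableSet ((fun x => M + x) '' B) :=
    (hB.image (by fun_prop)).isClosed.measurableSet
  calc volume A + volume B = volume ((fun x => x + m) '' A ∪ (fun x => M + x) '' B) := by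
        rw [measure_union₀ hBm.nullMeasurableSet hdisj, h1, h2]
    _ ≤ volume C := measure_mono hsub

/-- One-dimensional Brunn–Minkowski inequality for measurable sets. -/
theorem volume_add_volume_le {A B C : Set ℝ} (hA : MeasurableSet A) (hB : MeasurableSet B)
    (hA0 : A.Nonempty) (hB0 : B.Nonempty) (h : ∀ a ∈ A, ∀ b ∈ B, a + b ∈ C) :
    volume A + volume B ≤ volume C := by
  obtain ⟨a₀, ha₀⟩ := hA0
  obtain ⟨b₀, hb₀⟩ := hB0
  refine le_of_forall_lt fun r hr => ?_
  rw [hA.measure_eq_iSup_isCompact, hB.measure_eq_iSup_isCompact] at hr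
  refine hr.trans_le ?_
  simp only [iSup_and']
  refine ENNReal.biSup_add_biSup_le' ⟨∅, by simp⟩ ⟨∅, by simp⟩ ?_
  rintro A' ⟨hA's, hA'⟩ B' ⟨hB's, hB'⟩
  refine le_trans (add_le_add (measure_mono (subset_insert a₀ A'))
    (measure_mono (subset_insert b₀ B'))) ?_
  refine volume_add_volume_le_of_isCompact (hA'.insert _) (hB'.insert _) (by simp) (by simp) ?_
  intro a ha b hb
  exact h a (insert_subset ha₀ hA's ha) b (insert_subset hb₀ hB's hb)

/-- Weighted one-dimensional Brunn–Minkowski inequality. -/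
theorem mul_volume_add_mul_volume_le {p q : ℝ} (hp : 0 < p) (hq : 0 < q) {A B C : Set ℝ}
    (hA : MeasurableSet A) (hB : MeasurableSet B) (hA0 : A.Nonempty) (hB0 : B.Nonempty)
    (h : ∀ a ∈ A, ∀ b ∈ B, p * a + q * b ∈ C) :
    ENNReal.ofReal p * volume A + ENNReal.ofReal q * volume B ≤ volume C := by
  have key := volume_add_volume_le (A := (p • A : Set ℝ)) (B := (q • B : Set ℝ)) (C := C)
    (hA.const_smul_of_ne_zero hp.ne') (hB.const_smul_of_ne_zero hq.ne')
    (hA0.smul_set) (hB0.smul_set) (by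
      rintro _ ⟨a, ha, rfl⟩ _ ⟨b, hb, rfl⟩
      exact h a ha b hb)
  rwa [Measure.addHaar_smul, Measure.addHaar_smul, Module.finrank_self, pow_one, pow_one,
    abs_of_pos hp, abs_of_pos hq] at key

theorem lintegral_eq_lintegral_Ioo_meas_lt {f : ℝ → ℝ≥0∞} (hf : Measurable f) (hf1 : ∀ x, f x ≤ 1) :
    ∫⁻ x, f x = ∫⁻ t in Ioo (0 : ℝ) 1, volume {x | ENNReal.ofReal t < f x} := by
  have hne : ∀ x, f x ≠ ∞ := fun x => ((hf1 x).trans_lt ENNReal.one_lt_top).ne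
  have h1 := lintegral_eq_lintegral_meas_lt (f := fun x => (f x).toReal) volume
    (Filter.Eventually.of_forall fun x => ENNReal.toReal_nonneg) hf.ennreal_toReal.aemeasurable
  simp only [ENNReal.ofReal_toReal (hne _)] at h1
  rw [h1, ← Ioo_union_Ici_eq_Ioi (zero_lt_one' ℝ), lintegral_union measurableSet_Ici]
  · have h2 : ∫⁻ t in Ici (1 : ℝ), volume {a | t < (f a).toReal} = 0 := by
      rw [setLIntegral_congr_fun (g := fun _ => 0) measurableSet_Ici]
      · simp
      · intro t ht
        have : {a | t < (f a).toReal} = ∅ := by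
          ext a
          have := ENNReal.toReal_mono ENNReal.one_ne_top (hf1 a)
          simp only [ENNReal.toReal_one] at this
          simpa using this.trans ht
        simp [this]
    rw [h2, add_zero]
    refine setLIntegral_congr_fun measurableSet_Ioo fun t ht => ?_
    simp only [ENNReal.ofReal_lt_iff_lt_toReal ht.1.le (hne _)]
  · exact disjoint_left.2 fun x hx hx' => not_lt.2 hx' hx.2

/-- A form of the one-dimensional Prékopa–Leindler inequality for functions whose supremum is
one. -/
theorem prekopa_leindler_of_iSup_eq_one {p q : ℝ} (hp : 0 < p) (hq : 0 < q) (hpq : p + q = 1)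
    {f g h : ℝ → ℝ≥0∞} (hf : Measurable f) (hg : Measurable g) (hh : Measurable h)
    (hf1 : ⨆ x, f x = 1) (hg1 : ⨆ x, g x = 1)
    (hfgh : ∀ x y, f x ^ p * g y ^ q ≤ h (p * x + q * y)) :
    ENNReal.ofReal p * (∫⁻ x, f x) + ENNReal.ofReal q * (∫⁻ x, g x) ≤ ∫⁻ x, h x := by
  have hfle : ∀ x, f x ≤ 1 := fun x => hf1 ▸ le_iSup f x
  have hgle : ∀ x, g x ≤ 1 := fun x => hg1 ▸ le_iSup g x
  have hh' : Measurable fun x => min (h x) 1 := hh.min measurable_const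
  calc _ ≤ ∫⁻ x, min (h x) 1 := ?_
    _ ≤ _ := lintegral_mono fun x => min_le_left _ _
  rw [lintegral_eq_lintegral_Ioo_meas_lt hf hfle, lintegral_eq_lintegral_Ioo_meas_lt hg hgle,
    lintegral_eq_lintegral_Ioo_meas_lt hh' (fun x => min_le_right _ _)]
  rw [← lintegral_const_mul' _ _ ENNReal.ofReal_ne_top,
    ← lintegral_const_mul' _ _ ENNReal.ofReal_ne_top, ← lintegral_add_left']
  · refine setLIntegral_mono' measurableSet_Ioo fun t ht => ?_
    have ht1 : ENNReal.ofReal t < 1 := by simpa using ht.2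
    refine mul_volume_add_mul_volume_le hp hq (measurableSet_lt measurable_const hf)
      (measurableSet_lt measurable_const hg) ?_ ?_ ?_
    · exact lt_iSup_iff.1 (hf1.symm ▸ ht1)
    · exact lt_iSup_iff.1 (hg1.symm ▸ ht1)
    · intro a ha b hb
      refine lt_min ?_ ht1
      refine lt_of_lt_of_le ?_ (hfgh a b)
      have h0 : ENNReal.ofReal t ≠ 0 := by simpa using ht.1
      calc ENNReal.ofReal t = ENNReal.ofReal t ^ p * ENNReal.ofReal t ^ q := by
            rw [← ENNReal.rpow_add _ _ h0 ENNReal.ofReal_ne_top, hpq, ENNReal.rpow_one]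
        _ < f a ^ p * g b ^ q :=
            ENNReal.mul_lt_mul (ENNReal.rpow_lt_rpow ha hp) (ENNReal.rpow_lt_rpow hb hq)
  · refine (Antitone.measurable ?_).aemeasurable.const_mul _
    intro s t hst
    exact measure_mono fun x (hx : _ < _) => (ENNReal.ofReal_le_ofReal hst).trans_lt hx

theorem ENNReal.rpow_mul_rpow_le_weighted {p q : ℝ} (hp : 0 < p) (hq : 0 < q) (hpq : p + q = 1)
    (a b : ℝ≥0∞) : a ^ p * b ^ q ≤ ENNReal.ofReal p * a + ENNReal.ofReal q * b := by
  have hc : (p⁻¹).HolderConjugate q⁻¹ := by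
    rw [Real.holderConjugate_iff]
    refine ⟨(one_lt_inv₀ hp).2 (by linarith), by simpa using hpq⟩
  have := ENNReal.young_inequality (a ^ p) (b ^ q) hc
  rwa [← ENNReal.rpow_mul, ← ENNReal.rpow_mul, mul_inv_cancel₀ hp.ne', mul_inv_cancel₀ hq.ne',
    ENNReal.rpow_one, ENNReal.rpow_one, ENNReal.ofReal_inv_of_pos hp, ENNReal.ofReal_inv_of_pos hq,
    ENNReal.div_eq_inv_mul, ENNReal.div_eq_inv_mul, inv_inv, inv_inv] at this

theorem prekopa_leindler_of_bounded {p q : ℝ} (hp : 0 < p) (hq : 0 < q) (hpq : p + q = 1)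
    {f g h : ℝ → ℝ≥0∞} (hf : Measurable f) (hg : Measurable g) (hh : Measurable h)
    (hf1 : ⨆ x, f x ≠ ∞) (hg1 : ⨆ x, g x ≠ ∞)
    (hfgh : ∀ x y, f x ^ p * g y ^ q ≤ h (p * x + q * y)) :
    (∫⁻ x, f x) ^ p * (∫⁻ x, g x) ^ q ≤ ∫⁻ x, h x := by
  set a := ⨆ x, f x with ha
  set b := ⨆ x, g x with hb
  by_cases ha0 : a = 0
  · have : ∀ x, f x = 0 := by simpa [ENNReal.iSup_eq_zero] using ha.symm.trans ha0
    simp [this, hp]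
  by_cases hb0 : b = 0
  · have : ∀ x, g x = 0 := by simpa [ENNReal.iSup_eq_zero] using hb.symm.trans hb0
    simp [this, hq]
  have key := prekopa_leindler_of_iSup_eq_one hp hq hpq (f := fun x => a⁻¹ * f x)
    (g := fun x => b⁻¹ * g x) (h := fun x => ((a⁻¹) ^ p * (b⁻¹) ^ q) * h x)
    (hf.const_mul _) (hg.const_mul _) (hh.const_mul _)
    (by rw [← ENNReal.mul_iSup, ← ha, ENNReal.inv_mul_cancel ha0 hf1])
    (by rw [← ENNReal.mul_iSup, ← hb, ENNReal.inv_mul_cancel hb0 hg1])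
    (by
      intro x y
      rw [ENNReal.mul_rpow_of_nonneg _ _ hp.le, ENNReal.mul_rpow_of_nonneg _ _ hq.le,
        mul_mul_mul_comm]
      gcongr
      exact hfgh x y)
  have key2 := (ENNReal.rpow_mul_rpow_le_weighted hp hq hpq _ _).trans key
  rw [lintegral_const_mul _ hf, lintegral_const_mul _ hg, lintegral_const_mul _ hh,
    ENNReal.mul_rpow_of_nonneg _ _ hp.le, ENNReal.mul_rpow_of_nonneg _ _ hq.le,
    mul_mul_mul_comm] at key2
  refine (ENNReal.mul_le_mul_iff_right ?_ ?_).1 key2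
  · refine mul_ne_zero ?_ ?_
    · simp [hp, hf1, hp.le, ENNReal.rpow_eq_zero_iff]
    · simp [hq, hg1, hq.le, ENNReal.rpow_eq_zero_iff]
  · refine ENNReal.mul_ne_top ?_ ?_
    · simp [ENNReal.rpow_eq_top_iff, ha0, hf1]
    · simp [ENNReal.rpow_eq_top_iff, hb0, hg1]

/-- The Prékopa–Leindler inequality on a measure space with a vector space structure, for the
weights `p` and `q`. -/
def PrekopaLeindler (p q : ℝ) (E : Type*) [AddCommGroup E] [Module ℝ E] [MeasureSpace E] : Prop :=
  ∀ f g h : E → ℝ≥0∞, Measurable f → Measurable g → Measurable h →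
    (∀ x y, f x ^ p * g y ^ q ≤ h (p • x + q • y)) →
    (∫⁻ x, f x) ^ p * (∫⁻ x, g x) ^ q ≤ ∫⁻ x, h x

theorem tendsto_lintegral_min_natCast {f : ℝ → ℝ≥0∞} (hf : Measurable f) :
    Filter.Tendsto (fun N : ℕ => ∫⁻ x, min (f x) N) Filter.atTop (nhds (∫⁻ x, f x)) := by
  refine lintegral_tendsto_of_tendsto_of_monotone
    (fun N => (hf.min measurable_const).aemeasurable) ?_ ?_
  · refine Filter.Eventually.of_forall fun x N M hNM => ?_
    exact min_le_min_left _ (by exact_mod_cast hNM)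
  · refine Filter.Eventually.of_forall fun x => ?_
    have := (tendsto_const_nhds (x := f x)).min ENNReal.tendsto_nat_nhds_top
    simpa using this

theorem prekopaLeindler_real {p q : ℝ} (hp : 0 < p) (hq : 0 < q) (hpq : p + q = 1) :
    PrekopaLeindler p q ℝ := by
  intro f g h hf hg hh hfgh
  by_cases hf0 : ∫⁻ x, f x = 0
  · simp [hf0, hp]
  by_cases hg0 : ∫⁻ x, g x = 0
  · simp [hg0, hq]
  have hF := ((ENNReal.continuous_rpow_const (y := p)).tendsto _).comp
    (tendsto_lintegral_min_natCast hf)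
  have hG := ((ENNReal.continuous_rpow_const (y := q)).tendsto _).comp
    (tendsto_lintegral_min_natCast hg)
  refine le_of_tendsto (ENNReal.Tendsto.mul hF (Or.inl ?_) hG (Or.inl ?_))
    (Filter.Eventually.of_forall fun N => ?_)
  · simp [ENNReal.rpow_eq_zero_iff, hf0, hp.le]
  · simp [ENNReal.rpow_eq_zero_iff, hg0, hq.le]
  · have hN : ∀ k : ℝ → ℝ≥0∞, ⨆ x, min (k x) (N : ℝ≥0∞) ≠ ∞ := fun k =>
      ((iSup_le fun x => min_le_right _ _).trans_lt (ENNReal.natCast_lt_top N)).ne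
    refine prekopa_leindler_of_bounded hp hq hpq (hf.min measurable_const)
      (hg.min measurable_const) hh (hN f) (hN g) fun x y => le_trans ?_ (hfgh x y)
    gcongr <;> exact min_le_left _ _

theorem PrekopaLeindler.prod {p q : ℝ} {E F : Type*} [AddCommGroup E] [Module ℝ E]
    [MeasureSpace E] [AddCommGroup F] [Module ℝ F] [MeasureSpace F]
    [SFinite (volume : Measure F)]
    (hE : PrekopaLeindler p q E) (hF : PrekopaLeindler p q F) : PrekopaLeindler p q (E × F) := by
  intro f g h hf hg hh hfgh
  rw [Measure.volume_eq_prod, lintegral_prod _ hf.aemeasurable, lintegral_prod _ hg.aemeasurable,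
    lintegral_prod _ hh.aemeasurable]
  refine hE _ _ _ hf.lintegral_prod_right' hg.lintegral_prod_right' hh.lintegral_prod_right' ?_
  intro x y
  exact hF _ _ _ (hf.comp measurable_prodMk_left) (hg.comp measurable_prodMk_left)
    (hh.comp measurable_prodMk_left) fun u v => hfgh (x, u) (y, v)

theorem PrekopaLeindler.of_measurePreserving {p q : ℝ} {E F : Type*} [AddCommGroup E] [Module ℝ E]
    [MeasureSpace E] [AddCommGroup F] [Module ℝ F] [MeasureSpace F]
    (hE : PrekopaLeindler p q E) {e : E → F} (he : MeasurePreserving e volume volume)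
    (hlin : ∀ x y, e (p • x + q • y) = p • e x + q • e y) : PrekopaLeindler p q F := by
  intro f g h hf hg hh hfgh
  rw [← he.lintegral_comp hf, ← he.lintegral_comp hg, ← he.lintegral_comp hh]
  refine hE _ _ _ (hf.comp he.measurable) (hg.comp he.measurable) (hh.comp he.measurable) ?_
  intro x y
  rw [hlin]
  exact hfgh _ _

theorem prekopaLeindler_pi {p q : ℝ} (hp : 0 < p) (hq : 0 < q) (hpq : p + q = 1) (n : ℕ) :
    PrekopaLeindler p q (Fin n → ℝ) := by
  induction n with
  | zero =>
    intro f g h hf hg hh hfgh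
    have hv : (volume : Measure (Fin 0 → ℝ)) = Measure.dirac 0 := Measure.volume_pi_eq_dirac 0
    rw [hv, lintegral_dirac' _ hf, lintegral_dirac' _ hg, lintegral_dirac' _ hh]
    simpa using hfgh 0 0
  | succ n ih =>
    refine ((prekopaLeindler_real hp hq hpq).prod ih).of_measurePreserving
      (volume_preserving_piFinSuccAbove (fun _ : Fin (n + 1) => ℝ) 0).symm ?_
    intro x y
    ext i
    refine Fin.cases ?_ (fun i => ?_) i <;>
      simp [MeasurableEquiv.piFinSuccAbove, Fin.insertNthEquiv]

theorem prekopaLeindler_euclideanSpace {p q : ℝ} (hp : 0 < p) (hq : 0 < q) (hpq : p + q = 1)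
    (n : ℕ) : PrekopaLeindler p q (EuclideanSpace ℝ (Fin n)) :=
  (prekopaLeindler_pi hp hq hpq n).of_measurePreserving (PiLp.volume_preserving_toLp (Fin n))
    fun _ _ => rfl

/-- The multiplicative Brunn–Minkowski inequality. -/
theorem brunn_minkowski {p q : ℝ} (hp : 0 < p) (hq : 0 < q) (hpq : p + q = 1) {n : ℕ}
    {A B C : Set (EuclideanSpace ℝ (Fin n))} (hA : MeasurableSet A) (hB : MeasurableSet B)
    (hC : MeasurableSet C) (h : ∀ a ∈ A, ∀ b ∈ B, p • a + q • b ∈ C) :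
    volume A ^ p * volume B ^ q ≤ volume C := by
  have := prekopaLeindler_euclideanSpace hp hq hpq n (A.indicator 1) (B.indicator 1)
    (C.indicator 1) (measurable_one.indicator hA) (measurable_one.indicator hB)
    (measurable_one.indicator hC) (by
      intro x y
      by_cases hx : x ∈ A
      · by_cases hy : y ∈ B
        · simp [hx, hy, h x hx y hy]
        · simp [hy, hq]
      · simp [hx, hp])
  simpa [lintegral_indicator_one, hA, hB, hC] using this

end PrekopaLeindler

section CoordinateFlow

theorem measurable_volume_line {E : Type*} [NormedAddCommGroup E] [NormedSpace ℝ E]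
    [MeasurableSpace E] [BorelSpace E] [SecondCountableTopology E] {A : Set E}
    (hA : MeasurableSet A) (e : E) :
    Measurable fun x : E => volume {t : ℝ | x + t • e ∈ A} := by
  have h : MeasurableSet ((fun z : E × ℝ => z.1 + z.2 • e) ⁻¹' A) :=
    (by fun_prop : Measurable fun z : E × ℝ => z.1 + z.2 • e) hA
  exact measurable_measure_prodMk_left h

theorem volume_line_add {E : Type*} [AddCommGroup E] [Module ℝ E] (A : Set E) (e x : E) (s : ℝ) :
    volume {t : ℝ | x + s • e + t • e ∈ A} = volume {t : ℝ | x + t • e ∈ A} := by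
  have : {t : ℝ | x + s • e + t • e ∈ A} = (fun t => s + t) ⁻¹' {t : ℝ | x + t • e ∈ A} := by
    ext t
    simp [add_smul, add_assoc]
  rw [this, measure_preimage_add]

/-- Reversibility of the one-directional hit-and-run step. -/
theorem setLIntegral_volume_line_comm {E : Type*} [NormedAddCommGroup E] [NormedSpace ℝ E]
    [MeasureSpace E] [BorelSpace E] [SecondCountableTopology E]
    [SFinite (volume : Measure E)] [(volume : Measure E).IsAddRightInvariant]
    {A B K : Set E} (hA : MeasurableSet A) (hB : MeasurableSet B) (hK : MeasurableSet K) (e : E) :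
    ∫⁻ x in A, volume {t : ℝ | x + t • e ∈ B} / volume {t : ℝ | x + t • e ∈ K} =
      ∫⁻ x in B, volume {t : ℝ | x + t • e ∈ A} / volume {t : ℝ | x + t • e ∈ K} := by
  set L : E → ℝ≥0∞ := fun x => (volume {t : ℝ | x + t • e ∈ K})⁻¹ with hL
  have hLm : Measurable L := (measurable_volume_line hK e).inv
  have hLinv : ∀ x (s : ℝ), L (x + s • e) = L x := fun x s => by
    simp only [hL, volume_line_add]
  have expand : ∀ {A B : Set E}, MeasurableSet A → MeasurableSet B →
      ∫⁻ x in A, volume {t : ℝ | x + t • e ∈ B} / volume {t : ℝ | x + t • e ∈ K} =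
        ∫⁻ x, ∫⁻ t : ℝ, A.indicator L x * B.indicator 1 (x + t • e) := by
    intro A B hA hB
    rw [← lintegral_indicator hA]
    refine lintegral_congr fun x => ?_
    have hBx : MeasurableSet {t : ℝ | x + t • e ∈ B} :=
      (by fun_prop : Measurable fun t : ℝ => x + t • e) hB
    have h1 : ∀ t : ℝ, B.indicator (1 : E → ℝ≥0∞) (x + t • e) =
        {t : ℝ | x + t • e ∈ B}.indicator 1 t := fun t => by
      simp [Set.indicator]
    have h2 : Measurable fun t : ℝ => B.indicator (1 : E → ℝ≥0∞) (x + t • e) :=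
      (measurable_one.indicator hB).comp (by fun_prop)
    rw [lintegral_const_mul _ h2]
    simp_rw [h1]
    rw [lintegral_indicator_one hBx]
    by_cases hx : x ∈ A
    · simp [hx, hL, ENNReal.div_eq_inv_mul]
    · simp [hx]
  have hjoint : ∀ {A B : Set E}, MeasurableSet A → MeasurableSet B →
      Measurable fun z : E × ℝ => A.indicator L z.1 * B.indicator 1 (z.1 + z.2 • e) := by
    intro A B hA hB
    exact ((hLm.indicator hA).comp measurable_fst).mul
      ((measurable_one.indicator hB).comp (by fun_prop))
  rw [expand hA hB, expand hB hA]
  rw [lintegral_lintegral_swap (f := fun x (t : ℝ) => A.indicator L x * B.indicator 1 (x + t • e))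
      (hjoint hA hB).aemeasurable,
    lintegral_lintegral_swap (f := fun x (t : ℝ) => B.indicator L x * A.indicator 1 (x + t • e))
      (hjoint hB hA).aemeasurable, ← lintegral_neg_eq_self]
  refine lintegral_congr fun t => ?_
  rw [← lintegral_add_right_eq_self _ (t • e)]
  refine lintegral_congr fun x => ?_
  have := hLinv x t
  by_cases h1 : x + t • e ∈ A <;> by_cases h2 : x ∈ B <;> simp [h1, h2, this]

/-- The rate at which the hit-and-run step in direction `e` changes membership in `S`. -/
noncomputable def escapeRate {E : Type*} [AddCommGroup E] [Module ℝ E] (K S : Set E) (e x : E) :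
    ℝ≥0∞ :=
  S.indicator (fun x => volume {t : ℝ | x + t • e ∈ K \ S} / volume {t : ℝ | x + t • e ∈ K}) x +
    (K \ S).indicator
      (fun x => volume {t : ℝ | x + t • e ∈ S} / volume {t : ℝ | x + t • e ∈ K}) x

variable {n : ℕ} {K S : Set (EuclideanSpace ℝ (Fin n))}

theorem measurable_escapeRate (hK : MeasurableSet K) (hS : MeasurableSet S)
    (e : EuclideanSpace ℝ (Fin n)) : Measurable (escapeRate K S e) :=
  (((measurable_volume_line (hK.diff hS) e).div (measurable_volume_line hK e)).indicator hS).add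
    (((measurable_volume_line hS e).div (measurable_volume_line hK e)).indicator (hK.diff hS))

theorem lintegral_escapeRate (hK : MeasurableSet K) (hS : MeasurableSet S)
    (e : EuclideanSpace ℝ (Fin n)) :
    ∫⁻ x, escapeRate K S e x =
      2 * ∫⁻ x in S, volume {t : ℝ | x + t • e ∈ K \ S} / volume {t : ℝ | x + t • e ∈ K} := by
  have hm : Measurable (S.indicator fun x =>
      volume {t : ℝ | x + t • e ∈ K \ S} / volume {t : ℝ | x + t • e ∈ K}) :=
    ((measurable_volume_line (hK.diff hS) e).div (measurable_volume_line hK e)).indicator hS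
  unfold escapeRate
  rw [lintegral_add_left hm, lintegral_indicator hS, lintegral_indicator (hK.diff hS),
    setLIntegral_volume_line_comm (hK.diff hS) hS hK, two_mul]

/-- Two points of a common chord on different sides of `S` have total escape rate at least one. -/
theorem one_le_escapeRate_add (hKc : Convex ℝ K) (hKb : IsCompact K) (hS : MeasurableSet S)
    (hSK : S ⊆ K) {e x y : EuclideanSpace ℝ (Fin n)} (he : e ≠ 0) {s : ℝ} (hy : y = x + s • e)
    (hxS : x ∈ S) (hyT : y ∈ K \ S) : 1 ≤ escapeRate K S e x + escapeRate K S e y := by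
  have hcont : Continuous fun t : ℝ => x + t • e := by fun_prop
  have hT : MeasurableSet (K \ S) := hKb.measurableSet.diff hS
  have hxT : x ∉ K \ S := fun h => h.2 hxS
  have hs : s ≠ 0 := by
    rintro rfl
    simp only [zero_smul, add_zero] at hy
    exact hyT.2 (hy ▸ hxS)
  have hval : escapeRate K S e x + escapeRate K S e y =
      volume {t : ℝ | x + t • e ∈ K} / volume {t : ℝ | x + t • e ∈ K} := by
    have hsplit : volume {t : ℝ | x + t • e ∈ K} =
        volume {t : ℝ | x + t • e ∈ K \ S} + volume {t : ℝ | x + t • e ∈ S} := by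
      rw [← measure_union (s₂ := {t : ℝ | x + t • e ∈ S}) _ (hcont.measurable hS)]
      · congr 1
        ext t
        have := @hSK (x + t • e)
        simp only [mem_ofPred_eq, mem_union, Set.mem_sdiff]
        tauto
      · exact disjoint_left.2 fun t h1 h2 => h1.2 h2
    simp only [escapeRate, indicator_of_mem hxS, indicator_of_notMem hxT, indicator_of_mem hyT,
      indicator_of_notMem hyT.2, add_zero, zero_add]
    simp only [hy, volume_line_add]
    rw [← ENNReal.add_div, ← hsplit]
  rw [hval, ENNReal.div_self]
  · have hsub : uIcc 0 s ⊆ {t : ℝ | x + t • e ∈ K} := by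
      have hconv : Convex ℝ {t : ℝ | x + t • e ∈ K} := by
        intro a ha b hb p q hp hq hpq
        have := hKc ha hb hp hq hpq
        rw [mem_ofPred_eq]
        convert this using 1
        rw [smul_add, smul_add, add_add_add_comm, ← add_smul, hpq, one_smul, smul_smul, smul_smul,
          ← add_smul, smul_eq_mul, smul_eq_mul]
      rw [← segment_eq_uIcc]
      refine hconv.segment_subset ?_ ?_
      · simpa using hSK hxS
      · simpa [← hy] using hyT.1
    intro h0
    have := measure_mono_null hsub h0
    rw [Real.volume_interval] at this
    simp [hs] at this
  · obtain ⟨C, hC⟩ := hKb.isBounded.exists_norm_le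
    have hb : Bornology.IsBounded {t : ℝ | x + t • e ∈ K} := by
      refine isBounded_iff_forall_norm_le.2 ⟨(C + ‖x‖) / ‖e‖, fun t ht => ?_⟩
      rw [le_div_iff₀ (norm_pos_iff.2 he), ← norm_smul]
      calc ‖t • e‖ = ‖(x + t • e) - x‖ := by simp
        _ ≤ ‖x + t • e‖ + ‖x‖ := norm_sub_le _ _
        _ ≤ C + ‖x‖ := by gcongr; exact hC _ ht
    exact hb.measure_lt_top.ne

theorem one_le_escapeRate_add_of_not_iff (hKc : Convex ℝ K) (hKb : IsCompact K)
    (hS : MeasurableSet S) (hSK : S ⊆ K) {e x y : EuclideanSpace ℝ (Fin n)} (he : e ≠ 0) {s : ℝ}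
    (hy : y = x + s • e) (hxK : x ∈ K) (hyK : y ∈ K) (h : ¬(x ∈ S ↔ y ∈ S)) :
    1 ≤ escapeRate K S e x + escapeRate K S e y := by
  by_cases hx : x ∈ S
  · exact one_le_escapeRate_add hKc hKb hS hSK he hy hx ⟨hyK, fun h' => h (iff_of_true hx h')⟩
  · rw [add_comm]
    refine one_le_escapeRate_add hKc hKb hS hSK he (s := -s) (by simp [hy]) ?_ ⟨hxK, hx⟩
    by_contra h'
    exact h (iff_of_false hx h')

/-- The volume of the set of points of `K'` that a short translation by coordinate steps moves
across the boundary of `S` is controlled by the ergodic flow. -/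
theorem volume_separated_le (hKc : Convex ℝ K) (hKb : IsCompact K) (hS : MeasurableSet S)
    (hSK : S ⊆ K) {K' : Set (EuclideanSpace ℝ (Fin n))} {α : ℝ}
    (hK' : ∀ x ∈ K', Metric.closedBall x α ⊆ K) {v : EuclideanSpace ℝ (Fin n)} (hv : ‖v‖ ≤ α)
    (J : Finset (Fin n)) :
    volume {x | x ∈ K' ∧ ¬(x ∈ S ↔ x + ∑ j ∈ J, v j • EuclideanSpace.single j (1 : ℝ) ∈ S)} ≤
      ∑ j ∈ J, 2 * ∫⁻ x, escapeRate K S (EuclideanSpace.single j 1) x := by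
  have hw : ∀ J : Finset (Fin n), ‖∑ j ∈ J, v j • EuclideanSpace.single j (1 : ℝ)‖ ≤ α := by
    intro J
    refine le_trans ?_ hv
    rw [EuclideanSpace.norm_eq, EuclideanSpace.norm_eq]
    refine Real.sqrt_le_sqrt (Finset.sum_le_sum fun i _ => ?_)
    simp only [WithLp.ofLp_sum, WithLp.ofLp_smul, Finset.sum_apply, Pi.smul_apply,
      PiLp.ofLp_single, Pi.single_apply, smul_eq_mul, mul_ite, mul_one, mul_zero]
    rw [Finset.sum_ite_eq]
    split_ifs <;> simp [sq_nonneg]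
  have hmem : ∀ J : Finset (Fin n), ∀ x ∈ K',
      x + ∑ j ∈ J, v j • EuclideanSpace.single j (1 : ℝ) ∈ K := fun J x hx =>
    hK' x hx (by simpa using hw J)
  induction J using Finset.induction_on with
  | empty => simp
  | insert j J hj ih =>
    set w : Finset (Fin n) → EuclideanSpace ℝ (Fin n) :=
      fun J => ∑ j ∈ J, v j • EuclideanSpace.single j (1 : ℝ) with hwdef
    have hstep : w (insert j J) = w J + v j • EuclideanSpace.single j (1 : ℝ) := by
      simp only [hwdef, Finset.sum_insert hj, add_comm]
    have hφ := measurable_escapeRate hKb.measurableSet hS (EuclideanSpace.single j (1 : ℝ))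
    rw [Finset.sum_insert (f := fun j => 2 * ∫⁻ x, escapeRate K S (EuclideanSpace.single j 1) x) hj,
      add_comm]
    calc volume {x | x ∈ K' ∧ ¬(x ∈ S ↔ x + w (insert j J) ∈ S)}
        ≤ volume ({x | x ∈ K' ∧ ¬(x ∈ S ↔ x + w J ∈ S)} ∪
            {x | 1 ≤ escapeRate K S (EuclideanSpace.single j 1) (x + w J) +
              escapeRate K S (EuclideanSpace.single j 1) (x + w (insert j J))}) := by
          refine measure_mono ?_
          rintro x ⟨hx, hne⟩
          by_cases h : x ∈ S ↔ x + w J ∈ S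
          · right
            refine one_le_escapeRate_add_of_not_iff hKc hKb hS hSK (s := v j) ?_ ?_ (hmem _ x hx)
              (hmem _ x hx) (by rwa [← h])
            · simp
            · rw [hstep, add_assoc]
          · exact Or.inl ⟨hx, h⟩
      _ ≤ _ := measure_union_le _ _
      _ ≤ (∑ j ∈ J, 2 * ∫⁻ x, escapeRate K S (EuclideanSpace.single j 1) x) +
            2 * ∫⁻ x, escapeRate K S (EuclideanSpace.single j 1) x := by
          refine add_le_add ih ?_
          have hφw : ∀ J, Measurable fun x =>
              escapeRate K S (EuclideanSpace.single j 1) (x + w J) := fun J =>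
            hφ.comp (measurable_add_const (w J))
          have := mul_meas_ge_le_lintegral (μ := volume) ((hφw J).add (hφw (insert j J))) 1
          rw [one_mul] at this
          refine this.trans_eq ?_
          simp only [Pi.add_apply]
          rw [lintegral_add_left (hφw J),
            lintegral_add_right_eq_self (escapeRate K S (EuclideanSpace.single j 1)),
            lintegral_add_right_eq_self (escapeRate K S (EuclideanSpace.single j 1)), two_mul]

theorem volume_separated_le_charP (hKc : Convex ℝ K) (hKb : IsCompact K) (hS : MeasurableSet S)
    (hSK : S ⊆ K) {K' : Set (EuclideanSpace ℝ (Fin n))} {α : ℝ}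
    (hK' : ∀ x ∈ K', Metric.closedBall x α ⊆ K) (hn : n ≠ 0) {v : EuclideanSpace ℝ (Fin n)}
    (hv : ‖v‖ ≤ α) :
    volume {x | x ∈ K' ∧ ¬(x ∈ S ↔ x + v ∈ S)} ≤ 4 * n * ∫⁻ x in S, charP n K (K \ S) x := by
  have h := volume_separated_le hKc hKb hS hSK hK' hv Finset.univ
  have hv' : ∑ j, v j • EuclideanSpace.single j (1 : ℝ) = v := by
    ext i
    simp [Pi.single_apply]
  rw [hv'] at h
  refine h.trans_eq ?_
  have hm : ∀ j : Fin n, Measurable fun x : EuclideanSpace ℝ (Fin n) =>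
      volume {t : ℝ | x + t • EuclideanSpace.single j (1 : ℝ) ∈ K \ S} /
      volume {t : ℝ | x + t • EuclideanSpace.single j (1 : ℝ) ∈ K} := fun j =>
    (measurable_volume_line (hKb.measurableSet.diff hS) _).div
      (measurable_volume_line hKb.measurableSet _)
  simp only [charP, lintegral_escapeRate hKb.measurableSet hS]
  rw [lintegral_const_mul _ (Finset.measurable_sum _ fun j _ => hm j),
    lintegral_finsetSum _ fun j _ => hm j, ← mul_assoc, mul_assoc 4,
    ENNReal.mul_inv_cancel (by simpa using hn) (by simp), Finset.mul_sum]
  refine Finset.sum_congr rfl fun j _ => ?_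
  rw [← mul_assoc, mul_one]
  norm_num

end CoordinateFlow

section Geometry

variable {n : ℕ} {K S : Set (EuclideanSpace ℝ (Fin n))}

theorem volume_real_homothety_image (z : EuclideanSpace ℝ (Fin n)) {r : ℝ} (hr : 0 ≤ r)
    (A : Set (EuclideanSpace ℝ (Fin n))) :
    volume.real (AffineMap.homothety z r '' A) = r ^ n * volume.real A := by
  rw [measureReal_def, measureReal_def, Measure.addHaar_image_homothety, ENNReal.toReal_mul,
    finrank_euclideanSpace_fin, abs_of_nonneg (by positivity), ENNReal.toReal_ofReal (by positivity)]

theorem one_sub_natCast_mul_le_pow (n : ℕ) {t : ℝ} (ht : t ≤ 1) : 1 - n * t ≤ (1 - t) ^ n := by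
  have := one_add_mul_le_pow (a := -t) (by linarith) n
  simpa [sub_eq_add_neg] using this

/-- Points of a convex body are within `8nR` of its barycentre, where `R²` is its second moment. -/
theorem norm_sub_le_of_setAverage (hKc : Convex ℝ K) (hKb : IsCompact K) (hn : n ≠ 0)
    (hvol : 0 < volume.real K) (z : EuclideanSpace ℝ (Fin n)) {R : ℝ} (hR : 0 < R)
    (hRK : R ^ 2 = ⨍ x in K, ‖x - z‖ ^ 2) {x : EuclideanSpace ℝ (Fin n)} (hx : x ∈ K) :
    ‖x - z‖ ≤ 8 * n * R := by
  by_contra! hlt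
  have hn1 : (1 : ℝ) ≤ n := by exact_mod_cast Nat.one_le_iff_ne_zero.2 hn
  have hfin : volume K ≠ ∞ := hKb.measure_lt_top.ne
  have hcont : Continuous fun y : EuclideanSpace ℝ (Fin n) => ‖y - z‖ := by fun_prop
  have hfarm : MeasurableSet {y : EuclideanSpace ℝ (Fin n) | 2 * R ≤ ‖y - z‖} :=
    measurableSet_le measurable_const hcont.measurable
  have hmarkov : volume.real (K ∩ {y | 2 * R ≤ ‖y - z‖}) ≤ volume.real K / 4 := by
    have hint : IntegrableOn (fun y => ‖y - z‖ ^ 2) K :=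
      (Continuous.continuousOn (by fun_prop)).integrableOn_compact hKb
    have h := mul_meas_ge_le_integral_of_nonneg (μ := volume.restrict K)
      (Filter.Eventually.of_forall fun y => by positivity) hint ((2 * R) ^ 2)
    have hset : {y : EuclideanSpace ℝ (Fin n) | (2 * R) ^ 2 ≤ ‖y - z‖ ^ 2} =
        {y | 2 * R ≤ ‖y - z‖} := by
      ext y
      exact pow_le_pow_iff_left₀ (by positivity) (norm_nonneg _) two_ne_zero
    rw [hset, measureReal_restrict_apply hfarm, inter_comm] at h
    rw [setAverage_eq, smul_eq_mul, eq_inv_mul_iff_mul_eq₀ hvol.ne'] at hRK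
    rw [← hRK] at h
    have hR2 : 0 < R ^ 2 := by positivity
    have : R ^ 2 * (4 * volume.real (K ∩ {y | 2 * R ≤ ‖y - z‖})) ≤ R ^ 2 * volume.real K := by
      linarith
    linarith [le_of_mul_le_mul_left this hR2]
  have hnear : volume.real (K ∩ {y | 2 * R ≤ ‖y - z‖}ᶜ) ≥ 3 / 4 * volume.real K := by
    have := measureReal_inter_add_sdiff (μ := volume) (s := K) hfarm hfin
    rw [← Set.sdiff_eq]
    linarith
  have himage : AffineMap.homothety x (1 - 1 / (2 * n) : ℝ) '' (K ∩ {y | 2 * R ≤ ‖y - z‖}ᶜ) ⊆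
      K ∩ {y | 2 * R ≤ ‖y - z‖} := by
    rintro _ ⟨y, ⟨hyK, hy⟩, rfl⟩
    set l : ℝ := 1 / (2 * n) with hl
    have hl0 : 0 < l := by positivity
    have hl1 : l ≤ 1 := by
      rw [hl, div_le_one (by positivity)]
      linarith
    have heq : AffineMap.homothety x (1 - l) y = l • x + (1 - l) • y := by
      rw [AffineMap.homothety_apply, vsub_eq_sub, vadd_eq_add]
      module
    rw [heq]
    refine ⟨hKc hx hyK hl0.le (by linarith) (by ring), ?_⟩
    have hy' : ‖y - z‖ < 2 * R := by simpa using hy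
    have h1 : l * ‖x - z‖ > 4 * R := by
      calc l * ‖x - z‖ > l * (8 * n * R) := by gcongr
        _ = 4 * R := by
          rw [hl]
          field_simp
          norm_num
    have h2 : l • (x - z) = (l • x + (1 - l) • y - z) - (1 - l) • (y - z) := by module
    have h3 : ‖l • (x - z)‖ = l * ‖x - z‖ := by rw [norm_smul, Real.norm_of_nonneg hl0.le]
    have h4 : ‖(1 - l) • (y - z)‖ ≤ 2 * R := by
      rw [norm_smul, Real.norm_of_nonneg (by linarith)]
      nlinarith [norm_nonneg (y - z)]
    have h5 := norm_sub_le (l • x + (1 - l) • y - z) ((1 - l) • (y - z))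
    rw [← h2, h3] at h5
    rw [mem_ofPred_eq]
    linarith
  have hl1 : (1 : ℝ) / (2 * n) ≤ 1 := by
    rw [div_le_one (by positivity)]
    linarith
  have h6 := measureReal_mono himage (measure_ne_top_of_subset inter_subset_left hfin)
  rw [volume_real_homothety_image _ (by linarith)] at h6
  have h7 := one_sub_natCast_mul_le_pow n hl1
  have h8 : (n : ℝ) * (1 / (2 * n)) = 1 / 2 := by field_simp
  rw [h8] at h7
  nlinarith

/-- Brunn–Minkowski growth of a subset of a convex body of bounded diameter. -/
theorem volume_real_mul_le_of_combination {A B C : Set (EuclideanSpace ℝ (Fin n))}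
    (hA : MeasurableSet A) (hB : MeasurableSet B) (hC : MeasurableSet C)
    (hCfin : volume C ≠ ∞) {l : ℝ} (hl0 : 0 < l)
    (hl1 : l < 1) (h : ∀ a ∈ A, ∀ b ∈ B, (1 - l) • a + l • b ∈ C) {κ : ℝ}
    (hA0 : 0 < volume.real A) (hAB : volume.real A ≤ κ * volume.real B) :
    volume.real A * (1 + l * (1 - κ)) ≤ volume.real C := by
  have hbm := brunn_minkowski (by linarith : 0 < 1 - l) hl0 (by ring) hA hB hC h
  have hbm' : volume.real A ^ (1 - l) * volume.real B ^ l ≤ volume.real C := by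
    have := ENNReal.toReal_mono hCfin hbm
    rwa [ENNReal.toReal_mul, ← ENNReal.toReal_rpow, ← ENNReal.toReal_rpow] at this
  refine le_trans ?_ hbm'
  set a := volume.real A
  set b := volume.real B
  have hb : 0 < b := by
    have : 0 ≤ b := measureReal_nonneg
    rcases this.eq_or_lt with h0 | h0
    · rw [← h0] at hAB
      linarith
    · exact h0
  have hab : a ^ (1 - l) * b ^ l = a * (b / a) ^ l := by
    rw [Real.div_rpow hb.le hA0.le, Real.rpow_sub hA0, Real.rpow_one]
    field_simp
  have hκ : 0 < κ := pos_of_mul_pos_left (hA0.trans_le hAB) hb.le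
  have hlog : 1 - κ ≤ Real.log (b / a) := by
    have h1 := Real.one_sub_inv_le_log_of_pos (div_pos hb hA0)
    have h2 : (b / a)⁻¹ ≤ κ := by
      rw [inv_div, div_le_iff₀ hb]
      exact hAB
    linarith
  rw [hab]
  gcongr
  rw [Real.rpow_def_of_pos (div_pos hb hA0)]
  have := Real.add_one_le_exp (Real.log (b / a) * l)
  nlinarith

/-- The volume of the part of `S` within distance `α` of a point is Lipschitz in the point. -/
theorem volume_real_inter_closedBall_le (S : Set (EuclideanSpace ℝ (Fin n))) {α : ℝ} (hα : 0 < α)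
    (x y : EuclideanSpace ℝ (Fin n)) :
    volume.real (S ∩ Metric.closedBall x α) ≤ volume.real (S ∩ Metric.closedBall y α) +
      n * (‖x - y‖ / α) * volume.real (Metric.closedBall (0 : EuclideanSpace ℝ (Fin n)) α) := by
  have hfin : ∀ (w : EuclideanSpace ℝ (Fin n)) r, volume (Metric.closedBall w r) ≠ ∞ :=
    fun w r => measure_closedBall_lt_top.ne
  have hscale : ∀ (w : EuclideanSpace ℝ (Fin n)) {r : ℝ}, 0 ≤ r →
      volume.real (Metric.closedBall w r) =
        r ^ n * volume.real (Metric.ball (0 : EuclideanSpace ℝ (Fin n)) 1) := by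
    intro w r hr
    rw [measureReal_def, Measure.addHaar_closedBall _ _ hr, ENNReal.toReal_mul,
      finrank_euclideanSpace_fin, ENNReal.toReal_ofReal (by positivity), measureReal_def]
  set d := ‖x - y‖ with hd
  set b := volume.real (Metric.closedBall (0 : EuclideanSpace ℝ (Fin n)) α) with hb
  have hb0 : 0 ≤ b := measureReal_nonneg
  have hdiff : volume.real (Metric.closedBall x α \ Metric.closedBall y α) ≤ n * (d / α) * b := by
    rcases le_or_gt d α with hdα | hdα
    · have hsub : Metric.closedBall x (α - d) ⊆ Metric.closedBall x α ∩ Metric.closedBall y α := by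
        refine subset_inter (Metric.closedBall_subset_closedBall (by linarith [norm_nonneg (x - y)]))
          (Metric.closedBall_subset_closedBall' ?_)
        rw [dist_eq_norm]
        linarith
      have h1 := measureReal_mono hsub (measure_ne_top_of_subset inter_subset_left (hfin _ _))
      have h2 := measureReal_inter_add_sdiff (μ := volume) (s := Metric.closedBall x α)
        (Metric.isClosed_closedBall (x := y) (ε := α)).measurableSet (hfin _ _)
      have h3 : volume.real (Metric.closedBall x (α - d)) = (1 - d / α) ^ n * b := by
        rw [hb, hscale _ hα.le, hscale _ (by linarith), ← mul_assoc, ← mul_pow]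
        congr 2
        field_simp
      have h4 := one_sub_natCast_mul_le_pow n ((div_le_one hα).2 hdα)
      have h5 : volume.real (Metric.closedBall x α) = b := by rw [hb, hscale _ hα.le, hscale _ hα.le]
      have h6 := mul_le_mul_of_nonneg_right h4 hb0
      linarith
    · rcases Nat.eq_zero_or_pos n with rfl | hn
      · have : x = y := Subsingleton.elim _ _
        simp [this]
      · have hn1 : (1 : ℝ) ≤ n := by exact_mod_cast hn
        have h1 : 1 ≤ n * (d / α) := by
          have : 1 ≤ d / α := by rw [one_le_div hα]; exact hdα.le
          nlinarith
        calc _ ≤ volume.real (Metric.closedBall x α) := measureReal_mono sdiff_subset (hfin _ _)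
          _ = b := by rw [hb, hscale _ hα.le, hscale _ hα.le]
          _ ≤ _ := le_mul_of_one_le_left hb0 h1
  calc volume.real (S ∩ Metric.closedBall x α)
      ≤ volume.real (S ∩ Metric.closedBall y α ∪
          Metric.closedBall x α \ Metric.closedBall y α) := by
        refine measureReal_mono ?_ (measure_union_lt_top
          ((measure_mono inter_subset_right).trans_lt measure_closedBall_lt_top)
          ((measure_mono sdiff_subset).trans_lt measure_closedBall_lt_top)).ne
        rintro w ⟨hw, hwx⟩
        by_cases hwy : w ∈ Metric.closedBall y α
        · exact Or.inl ⟨hw, hwy⟩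
        · exact Or.inr ⟨hwx, hwy⟩
    _ ≤ _ := (measureReal_union_le _ _).trans (by gcongr)

theorem continuous_volume_real_inter_closedBall (S : Set (EuclideanSpace ℝ (Fin n))) {α : ℝ}
    (hα : 0 < α) : Continuous fun x => volume.real (S ∩ Metric.closedBall x α) := by
  set b := volume.real (Metric.closedBall (0 : EuclideanSpace ℝ (Fin n)) α)
  refine (LipschitzWith.of_le_add_mul (n / α * b).toNNReal fun x y => ?_).continuous
  refine (volume_real_inter_closedBall_le S hα x y).trans_eq ?_
  rw [Real.coe_toNNReal _ (by positivity), dist_eq_norm]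
  ring

/-- Points of a shrunk copy of `K` are the centres of balls contained in `K`. -/
theorem closedBall_subset_of_mem_homothety (hKc : Convex ℝ K) {z₀ : EuclideanSpace ℝ (Fin n)}
    (hz : Metric.closedBall z₀ 1 ⊆ K) {α : ℝ} (hα : 0 < α) (hα1 : α ≤ 1)
    {x : EuclideanSpace ℝ (Fin n)} (hx : x ∈ AffineMap.homothety z₀ (1 - α) '' K) :
    Metric.closedBall x α ⊆ K := by
  obtain ⟨y, hy, rfl⟩ := hx
  intro w hw
  set x := AffineMap.homothety z₀ (1 - α) y with hx
  have hu : z₀ + α⁻¹ • (w - x) ∈ K := by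
    refine hz ?_
    rw [mem_closedBall_iff_norm] at hw ⊢
    rw [add_sub_cancel_left, norm_smul, norm_inv, Real.norm_of_nonneg hα.le,
      inv_mul_le_iff₀ hα, mul_one]
    exact hw
  have := hKc hy hu (by linarith : 0 ≤ 1 - α) hα.le (by ring)
  convert this using 1
  rw [smul_add, smul_inv_smul₀ hα.ne', hx, AffineMap.homothety_apply, vsub_eq_sub, vadd_eq_add]
  module

end Geometry

section Isoperimetry

variable {n : ℕ} {K S : Set (EuclideanSpace ℝ (Fin n))}

theorem volume_le_of_volume_separated_le {K' : Set (EuclideanSpace ℝ (Fin n))}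
    (hK' : MeasurableSet K') (hS : MeasurableSet S) {α : ℝ} (hα : 0 < α) {E : ℝ≥0∞}
    (hE : ∀ v : EuclideanSpace ℝ (Fin n), ‖v‖ ≤ α →
      volume {x | x ∈ K' ∧ ¬(x ∈ S ↔ x + v ∈ S)} ≤ E) :
    volume {x | x ∈ K' ∧ volume.real (Metric.closedBall (0 : EuclideanSpace ℝ (Fin n)) α) / 3 ≤
      volume.real {v | v ∈ Metric.closedBall 0 α ∧ ¬(x ∈ S ↔ x + v ∈ S)}} ≤ 3 * E := by
  set B := Metric.closedBall (0 : EuclideanSpace ℝ (Fin n)) α with hB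
  have hBm : MeasurableSet B := Metric.isClosed_closedBall.measurableSet
  have hbfin : volume B ≠ ∞ := measure_closedBall_lt_top.ne
  have hb0 : volume B ≠ 0 := (Metric.measure_closedBall_pos _ _ hα).ne'
  set Z : Set (EuclideanSpace ℝ (Fin n) × EuclideanSpace ℝ (Fin n)) :=
    {z | z.1 ∈ K' ∧ z.2 ∈ B ∧ ¬(z.1 ∈ S ↔ z.1 + z.2 ∈ S)} with hZ
  have hZm : MeasurableSet Z := by
    have h1 : MeasurableSet {z : EuclideanSpace ℝ (Fin n) × EuclideanSpace ℝ (Fin n) | z.1 ∈ S} :=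
      measurable_fst hS
    have h2 : MeasurableSet
        {z : EuclideanSpace ℝ (Fin n) × EuclideanSpace ℝ (Fin n) | z.1 + z.2 ∈ S} :=
      measurable_add hS
    exact (measurable_fst hK').inter ((measurable_snd hBm).inter (h1.iff h2).compl)
  have htotal : (volume.prod volume) Z ≤ E * volume B := by
    rw [Measure.prod_apply_symm hZm, ← lintegral_indicator_const hBm]
    refine lintegral_mono fun v => ?_
    by_cases hv : v ∈ B
    · rw [indicator_of_mem hv]
      refine (measure_mono ?_).trans (hE v (by simpa [hB] using hv))
      rintro x ⟨h1, _, h3⟩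
      exact ⟨h1, h3⟩
    · have : (fun x => (x, v)) ⁻¹' Z = ∅ := by
        ext x
        simp [hZ, hv]
      simp [this]
  rw [Measure.prod_apply hZm] at htotal
  have hmarkov := (mul_meas_ge_le_lintegral (μ := volume)
    (measurable_measure_prodMk_left (ν := volume) hZm) (volume B / 3)).trans htotal
  have hsub : {x | x ∈ K' ∧ volume.real B / 3 ≤
      volume.real {v | v ∈ B ∧ ¬(x ∈ S ↔ x + v ∈ S)}} ⊆
      {x | volume B / 3 ≤ volume (Prod.mk x ⁻¹' Z)} := by
    rintro x ⟨hx, hle⟩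
    have heq : Prod.mk x ⁻¹' Z = {v | v ∈ B ∧ ¬(x ∈ S ↔ x + v ∈ S)} := by
      ext v
      simp [hZ, hx]
    have hfin : volume {v | v ∈ B ∧ ¬(x ∈ S ↔ x + v ∈ S)} ≠ ∞ :=
      measure_ne_top_of_subset (fun v hv => hv.1) hbfin
    rw [mem_ofPred_eq, heq, ← ENNReal.toReal_le_toReal (by simp [ENNReal.div_eq_top, hbfin]) hfin,
      ENNReal.toReal_div]
    exact hle
  refine (measure_mono hsub).trans ?_
  have hb30 : volume B / 3 ≠ 0 := by simp [ENNReal.div_eq_zero_iff, hb0]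
  have hb3t : volume B / 3 ≠ ∞ := by simp [ENNReal.div_eq_top, hbfin]
  refine (ENNReal.mul_le_mul_iff_right hb30 hb3t).1 (hmarkov.trans_eq ?_)
  rw [← mul_assoc, ENNReal.div_mul_cancel (by simp) (by simp), mul_comm]

theorem volume_real_add_mem (S : Set (EuclideanSpace ℝ (Fin n))) (α : ℝ)
    (x : EuclideanSpace ℝ (Fin n)) :
    volume.real {v | v ∈ Metric.closedBall 0 α ∧ x + v ∈ S} =
      volume.real (S ∩ Metric.closedBall x α) := by
  have : {v | v ∈ Metric.closedBall 0 α ∧ x + v ∈ S} =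
      (fun v => x + v) ⁻¹' (S ∩ Metric.closedBall x α) := by
    ext v
    simp [and_comm]
  rw [this, measureReal_def, measure_preimage_add, measureReal_def]

theorem volume_real_separated_of_mem (hS : MeasurableSet S) (α : ℝ)
    {x : EuclideanSpace ℝ (Fin n)} (hx : x ∈ S) :
    volume.real {v | v ∈ Metric.closedBall 0 α ∧ ¬(x ∈ S ↔ x + v ∈ S)} =
      volume.real (Metric.closedBall (0 : EuclideanSpace ℝ (Fin n)) α) -
        volume.real (S ∩ Metric.closedBall x α) := by
  have hm : MeasurableSet {v | x + v ∈ S} := measurable_const_add x hS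
  have h := measureReal_inter_add_sdiff (μ := volume)
    (s := Metric.closedBall (0 : EuclideanSpace ℝ (Fin n)) α) hm measure_closedBall_lt_top.ne
  rw [← volume_real_add_mem, ← h]
  have h1 : {v | v ∈ Metric.closedBall 0 α ∧ ¬(x ∈ S ↔ x + v ∈ S)} =
      Metric.closedBall 0 α \ {v | x + v ∈ S} := by
    ext v
    simp [hx]
  have h2 : {v | v ∈ Metric.closedBall 0 α ∧ x + v ∈ S} =
      Metric.closedBall 0 α ∩ {v | x + v ∈ S} := rfl
  rw [h1, h2]
  ring

theorem volume_real_separated_of_notMem (α : ℝ) {x : EuclideanSpace ℝ (Fin n)} (hx : x ∉ S) :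
    volume.real {v | v ∈ Metric.closedBall 0 α ∧ ¬(x ∈ S ↔ x + v ∈ S)} =
      volume.real (S ∩ Metric.closedBall x α) := by
  rw [← volume_real_add_mem]
  simp [hx]

/-- A set `S` that is rarely separated by short translations, up to volume `E`, cannot occupy a
nontrivial part of a convex body unless `E` is large. -/
theorem mul_volume_le_of_volume_separated_le (hKc : Convex ℝ K) (hKb : IsCompact K) (hn : n ≠ 0)
    {z₀ : EuclideanSpace ℝ (Fin n)} (hz : Metric.closedBall z₀ 1 ⊆ K) {D : ℝ} (hD1 : 1 ≤ D)
    (hD : ∀ x ∈ K, ∀ y ∈ K, ‖x - y‖ ≤ D) {s : ℝ} (hs : 0 < s) (hs2 : s ≤ 1 / 2)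
    (hS : MeasurableSet S) (hSK : S ⊆ K) (hσs : s * volume.real K ≤ volume.real S)
    (hσ2 : volume.real S ≤ volume.real K / 2) (hσ0 : 0 < volume.real S) {E : ℝ}
    (hE0 : 0 ≤ E)
    (hE : ∀ v : EuclideanSpace ℝ (Fin n), ‖v‖ ≤ s / (4 * n) →
      volume {x | x ∈ AffineMap.homothety z₀ (1 - s / (4 * n)) '' K ∧ ¬(x ∈ S ↔ x + v ∈ S)} ≤
        ENNReal.ofReal E) :
    s / (12 * n ^ 2 * D) * volume.real S ≤ 21 * E := by
  have hn1 : (1 : ℝ) ≤ n := by exact_mod_cast Nat.one_le_iff_ne_zero.2 hn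
  have hKfin : volume K ≠ ∞ := hKb.measure_lt_top.ne
  set α : ℝ := s / (4 * n) with hαdef
  have hα : 0 < α := by positivity
  have hα1 : α ≤ 1 := by
    rw [hαdef, div_le_one (by positivity)]
    linarith
  have hnα : n * α = s / 4 := by rw [hαdef]; field_simp
  set K' := AffineMap.homothety z₀ (1 - α) '' K with hK'
  have hz₀K : z₀ ∈ K := hz (Metric.mem_closedBall_self zero_le_one)
  have hK'K : K' ⊆ K := fun x hx =>
    closedBall_subset_of_mem_homothety hKc hz hα hα1 hx (Metric.mem_closedBall_self hα.le)
  have hK'c : IsCompact K' := hKb.image (AffineMap.homothety_continuous z₀ (1 - α))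
  have hK'conv : Convex ℝ K' := hKc.affine_image _
  have hK'vol : volume.real K * (1 - s / 4) ≤ volume.real K' := by
    rw [hK', volume_real_homothety_image _ (by linarith), mul_comm, ← hnα]
    exact mul_le_mul_of_nonneg_right (one_sub_natCast_mul_le_pow n hα1) measureReal_nonneg
  have hK'fin : volume K' ≠ ∞ := hK'c.measure_lt_top.ne
  set G : EuclideanSpace ℝ (Fin n) → ℝ := fun x => volume.real (S ∩ Metric.closedBall x α)
  have hG : Continuous G := continuous_volume_real_inter_closedBall S hα
  set b := volume.real (Metric.closedBall (0 : EuclideanSpace ℝ (Fin n)) α) with hb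
  have hb0 : 0 < b := ENNReal.toReal_pos (Metric.measure_closedBall_pos _ _ hα).ne'
    measure_closedBall_lt_top.ne
  set A := K' ∩ {x | 2 * b / 3 ≤ G x} with hA
  set M := K' ∩ {x | b / 3 ≤ G x} with hM
  have hAm : MeasurableSet A :=
    hK'c.measurableSet.inter (measurableSet_le measurable_const hG.measurable)
  have hMm : MeasurableSet M :=
    hK'c.measurableSet.inter (measurableSet_le measurable_const hG.measurable)
  have hMfin : volume M ≠ ∞ := measure_ne_top_of_subset inter_subset_left hK'fin
  have hAfin : volume A ≠ ∞ := measure_ne_top_of_subset inter_subset_left hK'fin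
  have hSfin : volume S ≠ ∞ := measure_ne_top_of_subset hSK hKfin
  have hsmall : ∀ Z ⊆ K', (∀ x ∈ Z, b / 3 ≤
      volume.real {v | v ∈ Metric.closedBall 0 α ∧ ¬(x ∈ S ↔ x + v ∈ S)}) →
      volume.real Z ≤ 3 * E := by
    intro Z hZ hZW
    have h := volume_le_of_volume_separated_le hK'c.measurableSet hS hα hE
    have hsub : Z ⊆ {x | x ∈ K' ∧ b / 3 ≤
        volume.real {v | v ∈ Metric.closedBall 0 α ∧ ¬(x ∈ S ↔ x + v ∈ S)}} :=
      fun x hx => ⟨hZ hx, hZW x hx⟩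
    have h2 := (measure_mono hsub).trans h
    refine ENNReal.toReal_le_of_le_ofReal (by positivity) (h2.trans_eq ?_)
    rw [ENNReal.ofReal_mul (by norm_num)]
    norm_num
  have hWS : ∀ x ∈ S, G x < 2 * b / 3 → b / 3 ≤
      volume.real {v | v ∈ Metric.closedBall 0 α ∧ ¬(x ∈ S ↔ x + v ∈ S)} := by
    intro x hx hGx
    rw [volume_real_separated_of_mem hS α hx]
    change b / 3 ≤ b - G x
    linarith
  have hWT : ∀ x ∉ S, b / 3 ≤ G x → b / 3 ≤
      volume.real {v | v ∈ Metric.closedBall 0 α ∧ ¬(x ∈ S ↔ x + v ∈ S)} := by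
    intro x hx hGx
    rwa [volume_real_separated_of_notMem α hx]
  have h1 : volume.real ((S ∩ K') \ A) ≤ 3 * E := by
    refine hsmall _ (fun x hx => hx.1.2) fun x hx => hWS x hx.1.1 ?_
    by_contra! h
    exact hx.2 ⟨hx.1.2, h⟩
  have h2 : volume.real (A \ S) ≤ 3 * E := by
    refine hsmall _ (fun x hx => hx.1.1) fun x hx => hWT x hx.2 ?_
    have : 2 * b / 3 ≤ G x := hx.1.2
    linarith
  have h3 : volume.real (M \ A) ≤ 3 * E := by
    refine hsmall _ (fun x hx => hx.1.1) fun x hx => ?_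
    have hGx : G x < 2 * b / 3 := by
      by_contra! h
      exact hx.2 ⟨hx.1.1, h⟩
    by_cases hxS : x ∈ S
    · exact hWS x hxS hGx
    · exact hWT x hxS hx.1.2
  have hupper : volume.real A ≤ volume.real S + 3 * E := by
    refine (measureReal_mono (s₂ := S ∪ A \ S) (fun x hx => ?_) ?_).trans
      ((measureReal_union_le _ _).trans (by gcongr))
    · by_cases h : x ∈ S
      · exact Or.inl h
      · exact Or.inr ⟨hx, h⟩
    · exact (measure_union_lt_top hSfin.lt_top
        (measure_ne_top_of_subset sdiff_subset hAfin).lt_top).ne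
  have hgrow : volume.real M ≤ volume.real A + 3 * E := by
    refine (measureReal_mono (s₂ := A ∪ M \ A) (fun x hx => ?_) ?_).trans
      ((measureReal_union_le _ _).trans (by gcongr))
    · by_cases h : x ∈ A
      · exact Or.inl h
      · exact Or.inr ⟨hx, h⟩
    · exact (measure_union_lt_top hAfin.lt_top
        (measure_ne_top_of_subset sdiff_subset hMfin).lt_top).ne
  have hlower : volume.real S ≤ volume.real A + 3 * E + s / 4 * volume.real K := by
    have hKK' : volume.real (K \ K') ≤ s / 4 * volume.real K := by
      have := measureReal_sdiff_add_inter (μ := volume) (s := K) hK'c.measurableSet hKfin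
      rw [inter_eq_self_of_subset_right hK'K] at this
      linarith
    refine (measureReal_mono (s₂ := (A ∪ (S ∩ K') \ A) ∪ K \ K') (fun x hx => ?_) ?_).trans
      ((measureReal_union_le _ _).trans
        (add_le_add ((measureReal_union_le _ _).trans (by gcongr)) hKK'))
    · by_cases h : x ∈ K'
      · by_cases h' : x ∈ A
        · exact Or.inl (Or.inl h')
        · exact Or.inl (Or.inr ⟨⟨hx, h⟩, h'⟩)
      · exact Or.inr ⟨hSK hx, h⟩
    · refine measure_ne_top_of_subset ?_ hKfin
      rintro x ((hx | hx) | hx)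
      · exact hK'K hx.1
      · exact hSK hx.1.1
      · exact hx.1
  set l : ℝ := s / (12 * n ^ 2 * D) with hl
  have hl0 : 0 < l := by positivity
  have hl1 : l < 1 := by
    rw [hl, div_lt_one (by positivity)]
    have : 1 ≤ (n : ℝ) ^ 2 * D := one_le_mul_of_one_le_of_one_le (one_le_pow₀ hn1) hD1
    linarith
  have hcomb : ∀ a ∈ A, ∀ y ∈ K', (1 - l) • a + l • y ∈ M := by
    intro a ha y hy
    refine ⟨hK'conv ha.1 hy (by linarith) hl0.le (by ring), ?_⟩
    set w := (1 - l) • a + l • y with hw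
    have hdist : ‖a - w‖ ≤ l * D := by
      have : a - w = l • (a - y) := by rw [hw]; module
      rw [this, norm_smul, Real.norm_of_nonneg hl0.le]
      gcongr
      exact hD a (hK'K ha.1) y (hK'K hy)
    have hLip := volume_real_inter_closedBall_le S hα a w
    have hGa : 2 * b / 3 ≤ G a := ha.2
    have hbound : n * (‖a - w‖ / α) * b ≤ 1 / 3 * b := by
      gcongr
      calc n * (‖a - w‖ / α) ≤ n * (l * D / α) := by gcongr
        _ = 1 / 3 := by
          rw [hl, hαdef]
          field_simp
          norm_num
    change b / 3 ≤ G w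
    change G a ≤ G w + n * (‖a - w‖ / α) * b at hLip
    linarith
  rcases le_or_gt (volume.real S / 4) (3 * E) with hbig | hEsmall
  · have := mul_le_mul_of_nonneg_right hl1.le hσ0.le
    linarith
  · have hAS : volume.real S / 2 ≤ volume.real A := by linarith
    have hsK : s * volume.real K ≤ 1 / 2 * volume.real K :=
      mul_le_mul_of_nonneg_right hs2 measureReal_nonneg
    have hbm := volume_real_mul_le_of_combination (κ := 5 / 7) hAm hK'c.measurableSet hMm
      hMfin hl0 hl1 hcomb (by linarith) (by linarith)
    nlinarith

end Isoperimetry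

/-- for a convex body `K` containing a unit ball with
`R² = E‖x − z_K‖²`, the `s`-conductance of Coordinate Hit-and-Run on `K` is at least
`c·s/(R·n^{4.5}·log n)` for an absolute constant `c > 0`: the ergodic flow of every
measurable `S` with `s < π_K(S) ≤ 1/2` is at least that multiple of `π_K(S) − s`. -/
theorem char_s_conductance :
    ∃ c > (0 : ℝ), ∀ (n : ℕ) (K : Set (EuclideanSpace ℝ (Fin n))),
      Convex ℝ K → IsCompact K → (interior K).Nonempty →
      (∃ z₀, Metric.closedBall z₀ 1 ⊆ K) →
      ∀ R : ℝ, 0 < R → R ^ 2 = ⨍ x in K, ‖x - ⨍ y in K, y‖ ^ 2 →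
      ∀ s : ℝ, 0 < s → s ≤ 1 / 2 →
      ∀ S : Set (EuclideanSpace ℝ (Fin n)), MeasurableSet S → S ⊆ K →
        ENNReal.ofReal s < volume S / volume K → volume S / volume K ≤ 1 / 2 →
        (∫⁻ x in S, charP n K (K \ S) x ∂((volume K)⁻¹ • volume.restrict K)) ≥
          ENNReal.ofReal (c * s / (R * (n : ℝ) ^ (4.5 : ℝ) * Real.log n)) *
            (volume S / volume K - ENNReal.ofReal s) := by
  refine ⟨1 / 100000, by norm_num, ?_⟩
  intro n K hKc hKb hKi ⟨z₀, hz⟩ R hR hRK s hs hs2 S hS hSK hsS hS2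
  rcases lt_or_ge n 2 with hn2 | hn2
  · interval_cases n <;> simp
  have hn : n ≠ 0 := by omega
  have hn2' : (2 : ℝ) ≤ n := by exact_mod_cast hn2
  have hKfin : volume K ≠ ∞ := hKb.measure_lt_top.ne
  have hK0 : volume K ≠ 0 := (Measure.measure_pos_of_nonempty_interior _ hKi).ne'
  have hk : 0 < volume.real K := ENNReal.toReal_pos hK0 hKfin
  have hSfin : volume S ≠ ∞ := measure_ne_top_of_subset hSK hKfin
  have hπ : (volume S / volume K).toReal = volume.real S / volume.real K := ENNReal.toReal_div _ _
  have hπfin : volume S / volume K ≠ ∞ := by simp [ENNReal.div_eq_top, hSfin, hK0]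
  have hσs : s * volume.real K < volume.real S := by
    rw [ENNReal.ofReal_lt_iff_lt_toReal hs.le hπfin, hπ, lt_div_iff₀ hk] at hsS
    exact hsS
  have hσ2 : volume.real S ≤ volume.real K / 2 := by
    have := ENNReal.toReal_mono (by simp) hS2
    rw [hπ, div_le_iff₀ hk] at this
    simp only [one_div, ENNReal.toReal_inv, ENNReal.toReal_ofNat] at this
    linarith
  have hσ0 : 0 < volume.real S := lt_trans (by positivity) hσs
  have hflow : ∫⁻ x in S, charP n K (K \ S) x ∂((volume K)⁻¹ • volume.restrict K) =
      (volume K)⁻¹ * ∫⁻ x in S, charP n K (K \ S) x := by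
    rw [Measure.restrict_smul, lintegral_smul_measure, Measure.restrict_restrict hS,
      inter_eq_self_of_subset_left hSK, smul_eq_mul]
  rw [ge_iff_le, hflow]
  set F := ∫⁻ x in S, charP n K (K \ S) x with hF
  by_cases hFtop : F = ∞
  · rw [hFtop, ENNReal.mul_top (by simpa using hKfin)]
    exact le_top
  set z := ⨍ y in K, y
  have hnear := fun x hx => norm_sub_le_of_setAverage hKc hKb hn hk z hR hRK (x := x) hx
  have hdiam : ∀ x ∈ K, ∀ y ∈ K, ‖x - y‖ ≤ 16 * n * R := by
    intro x hx y hy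
    have := norm_sub_le (x - z) (y - z)
    rw [sub_sub_sub_cancel_right] at this
    linarith [hnear x hx, hnear y hy]
  have hD1 : 1 ≤ 16 * n * R := by
    have h := hdiam (z₀ + EuclideanSpace.single ⟨0, by omega⟩ (1 : ℝ)) (hz (by simp)) z₀
      (hz (by simp))
    simpa using h
  have hα : 0 < s / (4 * n) := by positivity
  have hα1 : s / (4 * n) ≤ 1 := by
    rw [div_le_one (by positivity)]
    linarith
  have hEeq : 4 * n * F = ENNReal.ofReal (4 * n * F.toReal) := by
    rw [ENNReal.ofReal_mul (by positivity), ENNReal.ofReal_toReal hFtop,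
      ENNReal.ofReal_mul (by positivity)]
    simp
  have key := mul_volume_le_of_volume_separated_le hKc hKb hn hz hD1 hdiam hs hs2 hS hSK hσs.le
    hσ2 hσ0 (E := 4 * n * F.toReal) (by positivity) (fun v hv => hEeq ▸
      volume_separated_le_charP hKc hKb hS hSK
        (fun x hx => closedBall_subset_of_mem_homothety hKc hz hα hα1 hx) hn hv)
  have hlog : 1 / 2 ≤ Real.log n :=
    (by linarith [Real.log_two_gt_d9] : 1 / 2 ≤ Real.log 2).trans
      (Real.log_le_log two_pos hn2')
  have hpow : (n : ℝ) ^ 4 ≤ (n : ℝ) ^ (4.5 : ℝ) := by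
    rw [← Real.rpow_natCast]
    exact Real.rpow_le_rpow_of_exponent_le (by linarith) (by norm_num)
  have hcoef : 1 / 100000 * s / (R * (n : ℝ) ^ (4.5 : ℝ) * Real.log n) * volume.real S ≤
      F.toReal := by
    have h1 : s / (12 * n ^ 2 * (16 * n * R)) * volume.real S =
        (s / (R * n ^ 4) * volume.real S) * (n / 192) := by
      field_simp
      norm_num
    have h2 : s / (R * n ^ 4) * volume.real S ≤ 192 * 84 * F.toReal := by
      rw [h1] at key
      have hnp : (0 : ℝ) < n / 192 := by positivity
      refine le_of_mul_le_mul_right (key.trans_eq ?_) hnp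
      ring
    have h3 : 1 / 100000 * s / (R * (n : ℝ) ^ (4.5 : ℝ) * Real.log n) ≤
        1 / 100000 * s / (R * (n : ℝ) ^ 4 * (1 / 2)) := by gcongr
    have h4 : 1 / 100000 * s / (R * (n : ℝ) ^ 4 * (1 / 2)) = 1 / 50000 * (s / (R * n ^ 4)) := by
      field_simp
      norm_num
    have h5 := mul_le_mul_of_nonneg_right (h3.trans_eq h4) hσ0.le
    have h6 : 0 ≤ F.toReal := ENNReal.toReal_nonneg
    linarith
  calc ENNReal.ofReal (1 / 100000 * s / (R * (n : ℝ) ^ (4.5 : ℝ) * Real.log n)) *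
        (volume S / volume K - ENNReal.ofReal s)
      ≤ ENNReal.ofReal (1 / 100000 * s / (R * (n : ℝ) ^ (4.5 : ℝ) * Real.log n)) *
        (volume S / volume K) := by gcongr; exact tsub_le_self
    _ = (volume K)⁻¹ * (ENNReal.ofReal
        (1 / 100000 * s / (R * (n : ℝ) ^ (4.5 : ℝ) * Real.log n) * volume.real S)) := by
        rw [ENNReal.ofReal_mul (by positivity), measureReal_def, ENNReal.ofReal_toReal hSfin,
          ENNReal.div_eq_inv_mul]
        ring
    _ ≤ (volume K)⁻¹ * F := by
        gcongr
        exact ENNReal.ofReal_le_of_le_toReal hcoef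
end
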